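/- arXiv:2412.13068 — 9 statements merged into one kernel-verified Lean document; each statement's English description precedes it below -/
import Mathlib

section
/- Let H be a real Hilbert space and C₁, C₂ ⊆ H closed convex nonempty sets. For every x ∈ C₁ ∩ C₂ the inclusion N_{C₁}(x) + N_{C₂}(x) ⊆ N_{C₁ ∩ C₂}(x) holds, where the sum is the Minkowski sum of sets. If moreover Slater's constraint qualification C₁ ∩ (interior of C₂) ≠ ∅ holds, then for every x ∈ C₁ ∩ C₂ one has the equality (additivity of normal cones) N_{C₁}(x) + N_{C₂}(x) = N_{C₁ ∩ C₂}(x). -/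
open RealInnerProductSpace Pointwise

/-- The outward normal cone to `C` at `x`. -/
def normalCone {H : Type*} [NormedAddCommGroup H] [InnerProductSpace ℝ H]
    (C : Set H) (x : H) : Set H :=
  {y : H | ∀ c ∈ C, ⟪y, c - x⟫ ≤ 0}

theorem normalCone_add_subset {H : Type*} [NormedAddCommGroup H] [InnerProductSpace ℝ H]
    {C₁ C₂ : Set H} {x : H} :
    normalCone C₁ x + normalCone C₂ x ⊆ normalCone (C₁ ∩ C₂) x := by
  rintro _ ⟨y₁, h₁, y₂, h₂, rfl⟩ c hc
  simp only [inner_add_left]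
  exact add_nonpos (h₁ c hc.1) (h₂ c hc.2)

/-- The proof separates `interior C₂ × (-∞, 0)` from the epigraph of `c ↦ -⟪y, c - x⟫` on `C₁`. -/
theorem normalCone_inter_subset_add {H : Type*} [NormedAddCommGroup H] [InnerProductSpace ℝ H]
    [CompleteSpace H] {C₁ C₂ : Set H} (hC₁ : Convex ℝ C₁) (hC₂ : Convex ℝ C₂)
    (hne : (C₁ ∩ interior C₂).Nonempty) {x : H} (hx : x ∈ C₁ ∩ C₂) :
    normalCone (C₁ ∩ C₂) x ⊆ normalCone C₁ x + normalCone C₂ x := by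
  intro y hy
  obtain ⟨z, hz₁, hz₂⟩ := hne
  have hT : Convex ℝ {q : H × ℝ | q.1 ∈ C₁ ∧ -⟪y, q.1 - x⟫ ≤ q.2} := by
    rintro ⟨c, r⟩ ⟨hc, hr⟩ ⟨d, t⟩ ⟨hd, ht⟩ a b ha hb hab
    refine ⟨hC₁ hc hd ha hb hab, ?_⟩
    simp only [inner_sub_right, Prod.fst_add, Prod.snd_add, Prod.smul_fst, Prod.smul_snd,
      inner_add_right, real_inner_smul_right, smul_eq_mul] at hr ht ⊢
    obtain rfl : b = 1 - a := by linarith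
    nlinarith [mul_le_mul_of_nonneg_left hr ha, mul_le_mul_of_nonneg_left ht hb]
  have hdisj : Disjoint (interior C₂ ×ˢ Set.Iio (0 : ℝ))
      {q : H × ℝ | q.1 ∈ C₁ ∧ -⟪y, q.1 - x⟫ ≤ q.2} := by
    rw [Set.disjoint_left]
    rintro ⟨c, r⟩ ⟨hc, hr⟩ ⟨hc₁, hle⟩
    have := hy c ⟨hc₁, interior_subset hc⟩
    simp only [Set.mem_Iio] at hr hle
    linarith
  have hSconv : Convex ℝ (interior C₂ ×ˢ Set.Iio (0 : ℝ)) := hC₂.interior.prod (convex_Iio 0)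
  obtain ⟨f, u, hS, hfT⟩ := geometric_hahn_banach_open (E := H × ℝ) hSconv
    (isOpen_interior.prod isOpen_Iio) hT hdisj
  set p : H := (InnerProductSpace.toDual ℝ H).symm (f.comp (ContinuousLinearMap.inl ℝ H ℝ)) with hp
  set α : ℝ := f (0, 1) with hα
  have hf (c : H) (r : ℝ) : f (c, r) = ⟪p, c⟫ + r * α := by
    have h : ((c, r) : H × ℝ) = (c, 0) + r • (0, 1) := by simp
    rw [h, map_add, map_smul, hp, InnerProductSpace.toDual_symm_apply]
    simp [hα]
  have hC₂u (c : H) (hc : c ∈ C₂) : ⟪p, c⟫ ≤ u := by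
    have hmem : ((c, 0) : H × ℝ) ∈ closure (interior C₂ ×ˢ Set.Iio (0 : ℝ)) := by
      rw [closure_prod_eq, hC₂.closure_interior_eq_closure_of_nonempty_interior ⟨z, hz₂⟩,
        closure_Iio]
      exact ⟨subset_closure hc, Set.mem_Iic.2 le_rfl⟩
    have hle : closure (interior C₂ ×ˢ Set.Iio (0 : ℝ)) ⊆ {q : H × ℝ | f q ≤ u} :=
      closure_minimal (fun a ha => (hS a ha).le) (isClosed_le f.continuous continuous_const)
    have : f (c, 0) ≤ u := hle hmem
    simpa [hf] using this
  have hC₁u (c : H) (hc : c ∈ C₁) : u ≤ ⟪p, c⟫ - ⟪y, c - x⟫ * α := by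
    have := hfT (c, -⟪y, c - x⟫) ⟨hc, le_rfl⟩
    rw [hf] at this
    linarith
  have hα_pos : 0 < α := by
    have h₁ := hS (z, -1) ⟨hz₂, by simp⟩
    have h₂ := hC₁u z hz₁
    have h₃ := hy z ⟨hz₁, interior_subset hz₂⟩
    rw [hf] at h₁
    nlinarith
  have hxu : u = ⟪p, x⟫ := le_antisymm (by simpa using hC₁u x hx.1) (hC₂u x hx.2)
  refine ⟨y - α⁻¹ • p, fun c hc => ?_, α⁻¹ • p, fun c hc => ?_, sub_add_cancel _ _⟩
  · have h := hC₁u c hc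
    have h' : ⟪y, c - x⟫ ≤ α⁻¹ * ⟪p, c - x⟫ := by
      rw [inv_mul_eq_div, le_div_iff₀ hα_pos, inner_sub_right p]
      linarith
    rw [inner_sub_left, real_inner_smul_left]
    linarith
  · rw [real_inner_smul_left, inner_sub_right]
    exact mul_nonpos_of_nonneg_of_nonpos (inv_nonneg.2 hα_pos.le) (by linarith [hC₂u c hc])

/-- Subadditivity of normal cones, and additivity under Slater's constraint
qualification `C₁ ∩ int C₂ ≠ ∅`. The sum is the Minkowski sum of sets. -/
theorem stmt_1 {H : Type*} [NormedAddCommGroup H] [InnerProductSpace ℝ H] [CompleteSpace H]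
    (C₁ C₂ : Set H) (hC₁closed : IsClosed C₁) (hC₁conv : Convex ℝ C₁) (hC₁ne : C₁.Nonempty)
    (hC₂closed : IsClosed C₂) (hC₂conv : Convex ℝ C₂) (hC₂ne : C₂.Nonempty) :
    (∀ x ∈ C₁ ∩ C₂, normalCone C₁ x + normalCone C₂ x ⊆ normalCone (C₁ ∩ C₂) x) ∧
    ((C₁ ∩ interior C₂).Nonempty →
      ∀ x ∈ C₁ ∩ C₂, normalCone C₁ x + normalCone C₂ x = normalCone (C₁ ∩ C₂) x) := by
  exact ⟨fun x _ => normalCone_add_subset, fun hne x hx =>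
    normalCone_add_subset.antisymm (normalCone_inter_subset_add hC₁conv hC₂conv hne hx)⟩
end

section
/- Let H be a real Hilbert space, T > 0, and C : [0,T] → (subsets of H) a set-valued map such that every C(t) is closed, convex and nonempty, and C is Lipschitz continuous with constant L ≥ 0 with respect to the Hausdorff distance, i.e. d_H(C(t₁), C(t₂)) ≤ L·|t₁ − t₂| for all t₁, t₂ ∈ [0,T]. Then for every y₀ ∈ C(0) there exists a solution y : [0,T] → H of the sweeping process −y'(t) ∈ N_{C(t)}(y(t)), y(0) = y₀, and this solution is Lipschitz continuous with the same constant L; moreover it is the unique Lipschitz-continuous solution. -/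
open RealInnerProductSpace Set MeasureTheory
open scoped NNReal ENNReal

/-- `y` is a solution of the sweeping process on `[0, T]` driven by the moving set `C`
with initial value `y₀`: it starts at `y₀`, stays in the moving set, and for almost
every time its derivative exists and `-y'(t)` lies in the normal cone to `C t` at `y t`. -/
def IsSweepingSolution {H : Type*} [NormedAddCommGroup H] [InnerProductSpace ℝ H]
    (T : ℝ) (C : ℝ → Set H) (y₀ : H) (y : ℝ → H) : Prop :=
  y 0 = y₀ ∧ (∀ t ∈ Icc (0 : ℝ) T, y t ∈ C t) ∧
    ∀ᵐ t ∂(volume.restrict (Icc (0 : ℝ) T)),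
      ∃ d : H, HasDerivWithinAt y d (Icc (0 : ℝ) T) t ∧ -d ∈ normalCone (C t) (y t)

open Filter Topology

/-- An orthonormal family in a separable space is countable. -/
theorem Orthonormal.countable_of_separableSpace {E ι : Type*} [NormedAddCommGroup E]
    [InnerProductSpace ℝ E] [TopologicalSpace.SeparableSpace E] {v : ι → E}
    (hv : Orthonormal ℝ v) : Countable ι := by
  refine Pairwise.countable_of_isOpen_disjoint (s := fun i => Metric.ball (v i) (1 / 2)) ?_
    (fun _ => Metric.isOpen_ball) (fun i => ⟨v i, Metric.mem_ball_self (by norm_num)⟩)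
  intro i j hij
  refine Metric.ball_disjoint_ball ?_
  have h := norm_sub_sq_real (v i) (v j)
  rw [hv.1 i, hv.1 j, hv.2 hij] at h
  rw [dist_eq_norm]
  nlinarith [norm_nonneg (v i - v j)]

theorem Orthonormal.norm_sum_smul_sq {E ι : Type*} [NormedAddCommGroup E]
    [InnerProductSpace ℝ E] {v : ι → E} (hv : Orthonormal ℝ v) (s : Finset ι) (a : ι → ℝ) :
    ‖∑ i ∈ s, a i • v i‖ ^ 2 = ∑ i ∈ s, a i ^ 2 := by
  rw [← real_inner_self_eq_norm_sq, hv.inner_sum]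
  simp [sq]

/-- A Lipschitz curve in a separable Hilbert space is differentiable almost everywhere. -/
theorem LipschitzWith.ae_differentiableAt_of_separableSpace {E : Type*} [NormedAddCommGroup E]
    [InnerProductSpace ℝ E] [CompleteSpace E] [TopologicalSpace.SeparableSpace E]
    {K : ℝ≥0} {y : ℝ → E} (hy : LipschitzWith K y) : ∀ᵐ t, DifferentiableAt ℝ y t := by
  obtain ⟨w, b, -⟩ := exists_hilbertBasis ℝ E
  have : Countable w := b.orthonormal.countable_of_separableSpace
  have hcoord (i : w) : LipschitzWith K fun t => ⟪b i, y t⟫ := by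
    refine LipschitzWith.of_dist_le_mul fun s t => ?_
    rw [Real.dist_eq, ← inner_sub_right]
    refine (abs_real_inner_le_norm _ _).trans ?_
    rw [b.orthonormal.1, one_mul, ← dist_eq_norm]
    exact hy.dist_le_mul s t
  set f : w → ℝ → ℝ := fun i t => deriv (fun s => ⟪b i, y s⟫) t with hf
  have hdiff : ∀ᵐ t, ∀ i, HasDerivAt (fun s => ⟪b i, y s⟫) (f i t) t :=
    ae_all_iff.2 fun i => (hcoord i).ae_differentiableAt_real.mono fun t ht => ht.hasDerivAt
  have hsum_lip (s : Finset w) : LipschitzWith K fun t => ∑ i ∈ s, ⟪b i, y t⟫ • b i := by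
    refine LipschitzWith.of_dist_le_mul fun t u => le_trans ?_ (hy.dist_le_mul t u)
    rw [dist_eq_norm, dist_eq_norm, ← Finset.sum_sub_distrib]
    simp_rw [← sub_smul, ← inner_sub_right]
    refine le_of_sq_le_sq ?_ (norm_nonneg _)
    rw [b.orthonormal.norm_sum_smul_sq]
    simpa using b.orthonormal.sum_inner_products_le (y t - y u) (s := s)
  have hbound : ∀ᵐ t, ∀ s : Finset w, ‖∑ i ∈ s, f i t • b i‖ ≤ K := by
    filter_upwards [hdiff] with t ht s
    have h : HasDerivAt (fun t => ∑ i ∈ s, ⟪b i, y t⟫ • b i) (∑ i ∈ s, f i t • b i) t :=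
      HasDerivAt.fun_sum fun i _ => (ht i).smul_const (b i)
    rw [← h.deriv]
    exact norm_deriv_le_of_lipschitz (hsum_lip s)
  set g : ℝ → E := fun t => ∑' i, f i t • b i with hg
  have hgsum : ∀ᵐ t, HasSum (fun i => f i t • b i) (g t) ∧ ∀ i, ⟪b i, g t⟫ = f i t := by
    filter_upwards [hbound] with t ht
    have hmem : Memℓp (fun i => f i t) 2 := by
      refine memℓp_gen' (C := (K : ℝ) ^ 2) fun s => ?_
      have := pow_le_pow_left₀ (norm_nonneg _) (ht s) 2
      rw [b.orthonormal.norm_sum_smul_sq] at this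
      simpa using this
    have h := b.hasSum_repr_symm ⟨_, hmem⟩
    have hgt : g t = b.repr.symm ⟨_, hmem⟩ := h.tsum_eq
    refine ⟨hgt ▸ h, fun i => ?_⟩
    rw [hgt, ← b.repr_apply_apply]
    simp
  have hgK : ∀ᵐ t, ‖g t‖ ≤ K := by
    filter_upwards [hgsum, hbound] with t h₁ h₂
    exact le_of_tendsto h₁.1.norm (Eventually.of_forall h₂)
  have hgm : AEStronglyMeasurable g volume := by
    refine aestronglyMeasurable_of_tendsto_ae (u := atTop)
      (f := fun (s : Finset w) t => ∑ i ∈ s, f i t • b i) ?_ (hgsum.mono fun t ht => ht.1)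
    intro s
    refine Finset.aestronglyMeasurable_fun_sum s fun i _ => ?_
    exact ((measurable_deriv _).aestronglyMeasurable).smul_const (b i)
  have hgi (a c : ℝ) : IntervalIntegrable g volume a c :=
    (intervalIntegrable_const (c := (K : ℝ))).mono_fun hgm.restrict
      (ae_restrict_of_ae (hgK.mono fun t ht => by simpa using ht))
  have hgl : LocallyIntegrable g volume := by
    refine (locallyIntegrable_const (K : ℝ)).mono hgm (hgK.mono fun t ht => by simpa using ht)
  have hFTC (x : ℝ) : y x = y 0 + ∫ t in (0 : ℝ)..x, g t := by
    rw [← sub_eq_iff_eq_add']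
    refine b.repr.injective (lp.ext (funext fun i => ?_))
    rw [b.repr_apply_apply, b.repr_apply_apply, inner_sub_right]
    have h₁ := ((hcoord i).lipschitzOnWith
      (s := uIcc 0 x)).absolutelyContinuousOnInterval.integral_deriv_eq_sub
    have h₂ := (innerSL ℝ (b i)).intervalIntegral_comp_comm (hgi 0 x)
    simp only [innerSL_apply_apply] at h₂
    rw [← h₁, ← h₂]
    refine intervalIntegral.integral_congr_ae (hgsum.mono fun t ht _ => (ht.2 i).symm)
  filter_upwards [_root_.LocallyIntegrable.ae_hasDerivAt_integral hgl] with t ht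
  rw [funext hFTC]
  exact ((ht 0).const_add (y 0)).differentiableAt

/-- A Lipschitz curve in a Hilbert space is differentiable almost everywhere. -/
theorem LipschitzWith.ae_differentiableAt_of_innerProductSpace {E : Type*} [NormedAddCommGroup E]
    [InnerProductSpace ℝ E] [CompleteSpace E]
    {K : ℝ≥0} {y : ℝ → E} (hy : LipschitzWith K y) : ∀ᵐ t, DifferentiableAt ℝ y t := by
  set V := (Submodule.span ℝ (range y)).topologicalClosure
  have hV : TopologicalSpace.IsSeparable (V : Set E) :=
    (TopologicalSpace.isSeparable_range hy.continuous).span.closure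
  have : TopologicalSpace.SeparableSpace V := hV.separableSpace
  have : CompleteSpace V := (Submodule.isClosed_topologicalClosure _).completeSpace_coe
  have hmem (t : ℝ) : y t ∈ V :=
    Submodule.le_topologicalClosure _ (Submodule.subset_span (mem_range_self t))
  have hy' : LipschitzWith K fun t => (⟨y t, hmem t⟩ : V) := fun s t => hy s t
  filter_upwards [hy'.ae_differentiableAt_of_separableSpace] with t ht
  exact V.subtypeL.differentiableAt.comp t ht

/-- `u` is a catching-up scheme with time step `h` for the moving set `C`: the point `u (k + 1)` is
the projection of `u k` onto `C ((k + 1) * h)`. -/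
structure IsCatchingUp {H : Type*} [NormedAddCommGroup H] [InnerProductSpace ℝ H]
    (C : ℝ → Set H) (h : ℝ) (u : ℕ → H) : Prop where
  mem : ∀ k : ℕ, u k ∈ C (k * h)
  inner_nonpos : ∀ k : ℕ, ∀ w ∈ C ((k + 1 : ℕ) * h), ⟪u k - u (k + 1), w - u (k + 1)⟫ ≤ 0

section CatchingUp

variable {H : Type*} [NormedAddCommGroup H] [InnerProductSpace ℝ H] {C : ℝ → Set H}

theorem exists_mem_inner_nonpos {K : Set H} (hne : K.Nonempty) (hK : IsComplete K)
    (hconv : Convex ℝ K) (x : H) : ∃ v ∈ K, ∀ w ∈ K, ⟪x - v, w - v⟫ ≤ 0 := by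
  obtain ⟨v, hv, h⟩ := exists_norm_eq_iInf_of_complete_convex hne hK hconv x
  exact ⟨v, hv, (norm_eq_iInf_iff_real_inner_le_zero hconv hv).1 h⟩

theorem exists_isCatchingUp (hne : ∀ t, (C t).Nonempty) (hcomp : ∀ t, IsComplete (C t))
    (hconv : ∀ t, Convex ℝ (C t)) {y₀ : H} (hy₀ : y₀ ∈ C 0) (h : ℝ) :
    ∃ u, IsCatchingUp C h u ∧ u 0 = y₀ := by
  choose P hP hP' using fun t => exists_mem_inner_nonpos (hne t) (hcomp t) (hconv t)
  refine ⟨fun k => Nat.rec y₀ (fun k x => P ((k + 1 : ℕ) * h) x) k, ⟨fun k => ?_, fun k => ?_⟩, rfl⟩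
  · cases k with
    | zero => simpa using hy₀
    | succ k => exact hP _ _
  · exact hP' _ _

variable {L : ℝ≥0} {h : ℝ} {u : ℕ → H}

theorem IsCatchingUp.norm_sub_succ_le (hu : IsCatchingUp C h u) (hh : 0 ≤ h)
    (hC : ∀ s t, ∀ x ∈ C s, ∃ c ∈ C t, ‖x - c‖ ≤ L * |s - t|) (k : ℕ) :
    ‖u k - u (k + 1)‖ ≤ L * h := by
  obtain ⟨c, hc, hcle⟩ := hC _ ((k + 1 : ℕ) * h) _ (hu.mem k)
  have hdist : |(k : ℝ) * h - (k + 1 : ℕ) * h| = h := by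
    rw [show (k : ℝ) * h - (k + 1 : ℕ) * h = -h by push_cast; ring, abs_neg, abs_of_nonneg hh]
  rw [hdist] at hcle
  have h₁ := hu.inner_nonpos k c hc
  have h₂ := real_inner_le_norm (u k - u (k + 1)) (u k - c)
  have h₃ : ⟪u k - u (k + 1), c - u (k + 1)⟫ =
      ‖u k - u (k + 1)‖ ^ 2 - ⟪u k - u (k + 1), u k - c⟫ := by
    rw [← real_inner_self_eq_norm_sq, ← inner_sub_right]
    congr 1
    abel
  by_contra! hlt
  nlinarith [norm_nonneg (u k - c), mul_nonneg L.coe_nonneg hh]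

theorem IsCatchingUp.norm_sub_le (hu : IsCatchingUp C h u) (hh : 0 ≤ h)
    (hC : ∀ s t, ∀ x ∈ C s, ∃ c ∈ C t, ‖x - c‖ ≤ L * |s - t|) {i j : ℕ} (hij : i ≤ j) :
    ‖u i - u j‖ ≤ L * (j * h - i * h) := by
  induction j, hij using Nat.le_induction with
  | base => simp
  | succ j _ ih =>
    calc ‖u i - u (j + 1)‖ ≤ ‖u i - u j‖ + ‖u j - u (j + 1)‖ :=
          norm_sub_le_norm_sub_add_norm_sub _ _ _
      _ ≤ L * (j * h - i * h) + L * h := add_le_add ih (hu.norm_sub_succ_le hh hC j)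
      _ = L * ((j + 1 : ℕ) * h - i * h) := by push_cast; ring

theorem IsCatchingUp.norm_succ_sub_sq_le (hu : IsCatchingUp C h u) (hh : 0 ≤ h)
    (hC : ∀ s t, ∀ x ∈ C s, ∃ c ∈ C t, ‖x - c‖ ≤ L * |s - t|) {r : ℝ} {c : H} (hc : c ∈ C r)
    (k : ℕ) :
    ‖u (k + 1) - c‖ ^ 2 ≤ ‖u k - c‖ ^ 2 + 2 * L ^ 2 * h * |(k + 1 : ℕ) * h - r| := by
  obtain ⟨w, hw, hwle⟩ := hC r ((k + 1 : ℕ) * h) c hc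
  rw [abs_sub_comm] at hwle
  have h₁ := hu.inner_nonpos k w hw
  have h₂ : ⟪u k - u (k + 1), c - w⟫ ≤ (L * h) * (L * |(k + 1 : ℕ) * h - r|) :=
    (real_inner_le_norm _ _).trans <|
      mul_le_mul (hu.norm_sub_succ_le hh hC k) hwle (norm_nonneg _) (by positivity)
  have h₃ : ‖u k - c‖ ^ 2 = ‖u k - u (k + 1)‖ ^ 2 + ‖u (k + 1) - c‖ ^ 2 -
      2 * (⟪u k - u (k + 1), w - u (k + 1)⟫ + ⟪u k - u (k + 1), c - w⟫) := by
    rw [← inner_add_right, show u k - c = (u k - u (k + 1)) + (u (k + 1) - c) by abel,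
      norm_add_sq_real, show w - u (k + 1) + (c - w) = -(u (k + 1) - c) by abel, inner_neg_right]
    ring
  nlinarith [sq_nonneg ‖u k - u (k + 1)‖]

theorem IsCatchingUp.norm_sub_sq_le (hu : IsCatchingUp C h u) (hh : 0 ≤ h)
    (hC : ∀ s t, ∀ x ∈ C s, ∃ c ∈ C t, ‖x - c‖ ≤ L * |s - t|) {r δ : ℝ} {c : H} (hc : c ∈ C r)
    {i j : ℕ} (hij : i ≤ j) (hδ : ∀ k, i < k → k ≤ j → |k * h - r| ≤ δ) :
    ‖u j - c‖ ^ 2 ≤ ‖u i - c‖ ^ 2 + 2 * L ^ 2 * (j * h - i * h) * δ := by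
  induction j, hij using Nat.le_induction with
  | base => simp
  | succ j hj ih =>
    have h₁ := ih fun k hk hk' => hδ k hk (hk'.trans j.le_succ)
    have h₂ := hu.norm_succ_sub_sq_le hh hC hc j
    have h₃ : 2 * L ^ 2 * h * |(j + 1 : ℕ) * h - r| ≤ 2 * L ^ 2 * h * δ :=
      mul_le_mul_of_nonneg_left (hδ (j + 1) (Nat.lt_succ_of_le hj) le_rfl) (by positivity)
    push_cast at *
    linarith

/-- Comparison of a catching-up scheme with a refined one. -/
theorem IsCatchingUp.norm_sub_refinement_sq_le {h' : ℝ} {v : ℕ → H} {M : ℕ}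
    (hu : IsCatchingUp C h u) (hv : IsCatchingUp C h' v) (hh' : 0 ≤ h') (hM : M * h' = h)
    (h₀ : u 0 = v 0) (hC : ∀ s t, ∀ x ∈ C s, ∃ c ∈ C t, ‖x - c‖ ≤ L * |s - t|) (k : ℕ) :
    ‖v (M * k) - u k‖ ^ 2 ≤ 4 * L ^ 2 * h * (k * h) := by
  have hh : 0 ≤ h := hM ▸ by positivity
  have htime (k : ℕ) : ((M * k : ℕ) : ℝ) * h' = k * h := by rw [← hM]; push_cast; ring
  induction k with
  | zero => simp [h₀]
  | succ k ih =>
    have h₁ : ‖v (M * (k + 1)) - u (k + 1)‖ ^ 2 ≤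
        ‖v (M * k) - u (k + 1)‖ ^ 2 + 2 * L ^ 2 * h * h := by
      have := hv.norm_sub_sq_le hh' hC (hu.mem (k + 1)) (δ := h)
        (Nat.mul_le_mul_left M k.le_succ) fun j hj hj' => ?_
      · rw [htime, htime] at this
        convert this using 3
        push_cast
        ring
      · have h₁ : ((M * k : ℕ) : ℝ) * h' ≤ j * h' := by gcongr
        have h₂ : (j : ℝ) * h' ≤ (M * (k + 1) : ℕ) * h' := by gcongr
        rw [htime] at h₁ h₂
        push_cast at *
        rw [abs_le]
        constructor <;> linarith
    have h₂ : ‖u (k + 1) - v (M * k)‖ ^ 2 ≤ ‖u k - v (M * k)‖ ^ 2 + 2 * L ^ 2 * h * h := by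
      have := hu.norm_succ_sub_sq_le hh hC (htime k ▸ hv.mem (M * k)) k
      rwa [show ((k + 1 : ℕ) : ℝ) * h - k * h = h by push_cast; ring, abs_of_nonneg hh] at this
    rw [norm_sub_rev (u (k + 1)), norm_sub_rev (u k)] at h₂
    push_cast
    nlinarith

end CatchingUp

/-- The limit of the catching-up schemes. -/
theorem exists_limit_catchingUp {H : Type*} [NormedAddCommGroup H] [InnerProductSpace ℝ H]
    [CompleteSpace H] {C : ℝ → Set H} {L : ℝ≥0} (hne : ∀ t, (C t).Nonempty)
    (hclosed : ∀ t, IsClosed (C t)) (hconv : ∀ t, Convex ℝ (C t))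
    (hC : ∀ s t, ∀ x ∈ C s, ∃ c ∈ C t, ‖x - c‖ ≤ L * |s - t|) {y₀ : H} (hy₀ : y₀ ∈ C 0) :
    ∃ y : ℝ → H, y 0 = y₀ ∧ (∀ t, 0 ≤ t → y t ∈ C t) ∧
      (∀ s t, 0 ≤ s → s ≤ t → ‖y s - y t‖ ≤ L * (t - s)) ∧
      ∀ s t, 0 ≤ s → s ≤ t → ∀ c ∈ C s,
        ‖y t - c‖ ^ 2 ≤ ‖y s - c‖ ^ 2 + 2 * L ^ 2 * (t - s) * (t - s) := by
  set h : ℕ → ℝ := fun n => (1 / 2) ^ n with hdef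
  have hpos (n : ℕ) : 0 < h n := by positivity
  have hlim : Tendsto h atTop (𝓝 0) :=
    tendsto_pow_atTop_nhds_zero_of_lt_one (by norm_num) (by norm_num)
  choose u hu hu₀ using fun n =>
    exists_isCatchingUp hne (fun t => (hclosed t).isComplete) hconv hy₀ (h n)
  set N : ℕ → ℝ → ℕ := fun n t => ⌊t / h n⌋₊ with hN
  have hNle {t : ℝ} (ht : 0 ≤ t) (n : ℕ) : N n t * h n ≤ t :=
    (le_div_iff₀ (hpos n)).1 (Nat.floor_le (by have := hpos n; positivity))
  have hltN (t : ℝ) (n : ℕ) : t < (N n t + 1) * h n :=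
    (div_lt_iff₀ (hpos n)).1 (Nat.lt_floor_add_one _)
  have hmono {s t : ℝ} (hst : s ≤ t) (n : ℕ) : N n s ≤ N n t :=
    Nat.floor_le_floor (div_le_div_of_nonneg_right hst (hpos n).le)
  have hconvg (t : ℝ) (ht : 0 ≤ t) : ∃ x, Tendsto (fun n => u n (N n t)) atTop (𝓝 x) := by
    refine cauchySeq_tendsto_of_complete <| cauchySeq_of_le_tendsto_0'
      (fun n => √(4 * L ^ 2 * h n * t) + L * h n) (fun n m hnm => ?_) ?_
    · have hM : ((2 ^ (m - n) : ℕ) : ℝ) * h m = h n := by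
        obtain ⟨k, rfl⟩ := Nat.exists_eq_add_of_le hnm
        simp only [hdef, add_tsub_cancel_left, pow_add, Nat.cast_pow, Nat.cast_ofNat]
        rw [mul_left_comm, ← mul_pow]
        norm_num
      set M := 2 ^ (m - n)
      have h₁ := (hu n).norm_sub_refinement_sq_le (hu m) (hpos m).le hM (by rw [hu₀, hu₀]) hC
        (N n t)
      have h₂ : ‖u m (M * N n t) - u n (N n t)‖ ≤ √(4 * L ^ 2 * h n * t) := by
        refine Real.le_sqrt_of_sq_le (h₁.trans ?_)
        have := hpos n
        gcongr
        exact hNle ht n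
      have htime : ((M * N n t : ℕ) : ℝ) * h m = N n t * h n := by
        rw [← hM]; push_cast; ring
      have hle : M * N n t ≤ N m t := by
        refine Nat.le_floor ((le_div_iff₀ (hpos m)).2 ?_)
        rw [htime]
        exact hNle ht n
      have h₃ : ‖u m (M * N n t) - u m (N m t)‖ ≤ L * h n := by
        refine ((hu m).norm_sub_le (hpos m).le hC hle).trans ?_
        rw [htime]
        gcongr
        linarith [hNle ht m, hltN t n]
      rw [dist_eq_norm, norm_sub_rev]
      calc ‖u m (N m t) - u n (N n t)‖
          ≤ ‖u m (N m t) - u m (M * N n t)‖ + ‖u m (M * N n t) - u n (N n t)‖ :=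
            norm_sub_le_norm_sub_add_norm_sub _ _ _
        _ ≤ _ := by rw [norm_sub_rev]; linarith
    · have h₁ : Tendsto (fun n => √(4 * L ^ 2 * h n * t) + L * h n) atTop
          (𝓝 (√(4 * L ^ 2 * 0 * t) + L * 0)) :=
        ((hlim.const_mul _).mul_const t).sqrt.add (hlim.const_mul _)
      simpa using h₁
  choose! y hy using hconvg
  refine ⟨y, ?_, fun t ht => ?_, fun s t hs hst => ?_, fun s t hs hst c hc => ?_⟩
  · refine tendsto_nhds_unique (hy 0 le_rfl) ?_
    simp [hN, hu₀]
  · choose c hc hcle using fun n => hC _ t _ ((hu n).mem (N n t))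
    have h₁ : Tendsto (fun n => u n (N n t) - c n) atTop (𝓝 0) := by
      refine squeeze_zero_norm (a := fun n => L * h n) (fun n => (hcle n).trans ?_)
        (by simpa using hlim.const_mul (L : ℝ))
      gcongr
      rw [abs_le]
      constructor <;> linarith [hNle ht n, hltN t n, hpos n]
    refine (hclosed t).mem_of_tendsto (b := atTop) (f := c) ?_ (Eventually.of_forall hc)
    simpa using (hy t ht).sub h₁
  · have h₁ : Tendsto (fun n => L * (t - s + h n)) atTop (𝓝 (L * (t - s))) := by
      simpa using (hlim.const_add (t - s)).const_mul (L : ℝ)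
    refine le_of_tendsto_of_tendsto' ((hy s hs).sub (hy t (hs.trans hst))).norm h₁ fun n => ?_
    refine ((hu n).norm_sub_le (hpos n).le hC (hmono hst n)).trans ?_
    gcongr
    linarith [hNle (hs.trans hst) n, hltN s n]
  · have h₁ : Tendsto (fun n => ‖u n (N n s) - c‖ ^ 2 + 2 * L ^ 2 * (t - s + h n) * (t - s)) atTop
        (𝓝 (‖y s - c‖ ^ 2 + 2 * L ^ 2 * (t - s) * (t - s))) := by
      have h₂ := ((hlim.const_add (t - s)).const_mul (2 * (L : ℝ) ^ 2)).mul_const (t - s)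
      rw [add_zero] at h₂
      exact (((hy s hs).sub_const c).norm.pow 2).add h₂
    refine le_of_tendsto_of_tendsto' (((hy t (hs.trans hst)).sub_const c).norm.pow 2) h₁
      fun n => ?_
    refine ((hu n).norm_sub_sq_le (δ := t - s) (hpos n).le hC hc (hmono hst n)
      fun k hk hk' => ?_).trans ?_
    · have hp := hpos n
      have h₁ : ((N n s : ℝ) + 1) * h n ≤ k * h n := by
        gcongr
        exact_mod_cast hk
      have h₂ : (k : ℝ) * h n ≤ N n t * h n := by gcongr
      rw [abs_le]
      constructor <;> linarith [hNle (hs.trans hst) n, hltN s n]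
    · have : (0 : ℝ) ≤ t - s := sub_nonneg.2 hst
      gcongr
      linarith [hNle (hs.trans hst) n, hltN s n]

/-- A curve obeying the quadratic estimate satisfied by limits of catching-up schemes has its
derivatives in the opposite of the normal cone. -/
theorem neg_mem_normalCone_of_norm_sub_sq_le {H : Type*} [NormedAddCommGroup H]
    [InnerProductSpace ℝ H] {K : Set H} {y : ℝ → H} {d : H} {t T A : ℝ} (hy : HasDerivAt y d t)
    (htT : t < T)
    (h : ∀ s ∈ Ioo t T, ∀ c ∈ K, ‖y s - c‖ ^ 2 ≤ ‖y t - c‖ ^ 2 + A * (s - t) * (s - t)) :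
    -d ∈ normalCone K (y t) := by
  intro c hc
  have hφ : HasDerivAt (fun s => ‖y s - c‖ ^ 2) (2 * ⟪y t - c, d⟫) t :=
    (hy.sub_const c).norm_sq
  have h₁ := hφ.hasDerivWithinAt (s := Ioi t)
  rw [hasDerivWithinAt_iff_tendsto_slope' (by simp)] at h₁
  have h₂ : Tendsto (fun s => A * (s - t)) (𝓝[>] t) (𝓝 0) := by
    have : Continuous fun s => A * (s - t) := by fun_prop
    simpa using (this.tendsto t).mono_left nhdsWithin_le_nhds
  have h₃ : 2 * ⟪y t - c, d⟫ ≤ 0 := by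
    refine le_of_tendsto_of_tendsto h₁ h₂ ?_
    filter_upwards [Ioo_mem_nhdsGT htT] with s hs
    have hpos : 0 < s - t := sub_pos.2 hs.1
    rw [slope_def_field, div_le_iff₀ hpos]
    linarith [h s hs c hc]
  rw [inner_neg_left, ← inner_neg_right, neg_sub, real_inner_comm]
  linarith

/-- Two Lipschitz solutions of the sweeping process with the same initial value coincide. -/
theorem IsSweepingSolution.eq_of_lipschitzOnWith {H : Type*} [NormedAddCommGroup H]
    [InnerProductSpace ℝ H] {T : ℝ} {C : ℝ → Set H} {y₀ : H} {y z : ℝ → H} {K K' : ℝ≥0}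
    (hy : IsSweepingSolution T C y₀ y) (hz : IsSweepingSolution T C y₀ z)
    (hyK : LipschitzOnWith K y (Icc 0 T)) (hzK : LipschitzOnWith K' z (Icc 0 T))
    {t : ℝ} (ht : t ∈ Icc 0 T) : z t = y t := by
  have hsub : Icc 0 t ⊆ Icc 0 T := Icc_subset_Icc_right ht.2
  have h0 : (0 : ℝ) ∈ Icc 0 T := ⟨le_rfl, ht.1.trans ht.2⟩
  set w : ℝ → H := fun s => z s - y s with hw
  have hw0 : w 0 = 0 := by simp [hw, hy.1, hz.1]
  have hwK : LipschitzOnWith (K' + K) w (Icc 0 T) := hzK.sub hyK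
  have hbound {s : ℝ} (hs : s ∈ Icc 0 T) : ‖w s‖ ≤ (K' + K : ℝ≥0) * T := by
    have := hwK.norm_sub_le hs h0
    rw [hw0, sub_zero, sub_zero, Real.norm_of_nonneg hs.1] at this
    exact this.trans (by gcongr; exact hs.2)
  have hφ : LipschitzOnWith ((K' + K) * (2 * (K' + K) * T.toNNReal)) (fun s => ‖w s‖ ^ 2)
      (uIcc 0 t) := by
    rw [uIcc_of_le ht.1]
    refine LipschitzOnWith.of_dist_le_mul fun a ha b hb => ?_
    have ha' := hbound (hsub ha)
    have hb' := hbound (hsub hb)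
    have hab := (abs_norm_sub_norm_le (w a) (w b)).trans (hwK.norm_sub_le (hsub ha) (hsub hb))
    rw [Real.dist_eq, Real.dist_eq, sq_sub_sq, abs_mul, abs_of_nonneg (by positivity), mul_comm]
    rw [Real.norm_eq_abs] at hab
    push_cast at *
    rw [Real.coe_toNNReal _ (ht.1.trans ht.2)]
    calc |‖w a‖ - ‖w b‖| * (‖w a‖ + ‖w b‖)
        ≤ ((K' + K) * |a - b|) * (2 * (K' + K) * T) := by gcongr; linarith
      _ = _ := by ring
  have hderiv : ∀ᵐ s ∂volume.restrict (Ioc 0 t), deriv (fun s => ‖w s‖ ^ 2) s ≤ 0 := by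
    rw [ae_restrict_iff' measurableSet_Ioc]
    have hne : ∀ᵐ s : ℝ, s ≠ T := by simp [ae_iff, measure_singleton]
    filter_upwards [(ae_restrict_iff' measurableSet_Icc).1 hy.2.2,
      (ae_restrict_iff' measurableSet_Icc).1 hz.2.2, hne] with s h₁ h₂ hsT hs
    have hsI : s ∈ Icc 0 T := hsub (Ioc_subset_Icc_self hs)
    have hnhds : Icc 0 T ∈ 𝓝 s := Icc_mem_nhds hs.1 (lt_of_le_of_ne hsI.2 hsT)
    obtain ⟨d, hd, hdN⟩ := h₁ hsI
    obtain ⟨e, he, heN⟩ := h₂ hsI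
    have h₃ : HasDerivAt (fun s => ‖w s‖ ^ 2) (2 * ⟪w s, e - d⟫) s :=
      ((he.hasDerivAt hnhds).sub (hd.hasDerivAt hnhds)).norm_sq
    rw [h₃.deriv, real_inner_comm, inner_sub_left]
    have h₄ := hdN (z s) (hz.2.1 s hsI)
    have h₅ := heN (y s) (hy.2.1 s hsI)
    rw [inner_neg_left] at h₄ h₅
    rw [← neg_sub (z s), inner_neg_right] at h₅
    linarith
  have hint := hφ.absolutelyContinuousOnInterval.integral_deriv_eq_sub
  rw [intervalIntegral.integral_of_le ht.1, hw0] at hint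
  have hle := integral_nonpos_of_ae hderiv
  have hzero : ‖w t‖ ^ 2 ≤ 0 := by simpa [hint] using hle
  exact sub_eq_zero.1 (norm_eq_zero.1 (by nlinarith [norm_nonneg (w t)]))

/-- Existence and uniqueness for Moreau's sweeping process: if the moving set `C t` is
closed, convex, nonempty and Lipschitz in time with constant `L` with respect to the
Hausdorff distance, then for every initial point `y₀ ∈ C 0` there is a solution of the
sweeping process which is Lipschitz with the same constant `L`, and it is the unique
Lipschitz-continuous solution. -/
theorem stmt_3 {H : Type*} [NormedAddCommGroup H] [InnerProductSpace ℝ H] [CompleteSpace H]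
    (T : ℝ) (hT : 0 < T) (C : ℝ → Set H)
    (hclosed : ∀ t ∈ Icc (0 : ℝ) T, IsClosed (C t))
    (hconv : ∀ t ∈ Icc (0 : ℝ) T, Convex ℝ (C t))
    (hne : ∀ t ∈ Icc (0 : ℝ) T, (C t).Nonempty)
    (L : ℝ≥0)
    (hLip : ∀ t₁ ∈ Icc (0 : ℝ) T, ∀ t₂ ∈ Icc (0 : ℝ) T,
      EMetric.hausdorffEdist (C t₁) (C t₂) ≤ ENNReal.ofReal ((L : ℝ) * |t₁ - t₂|))
    (y₀ : H) (hy₀ : y₀ ∈ C 0) :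
    ∃ y : ℝ → H,
      (IsSweepingSolution T C y₀ y ∧ LipschitzOnWith L y (Icc (0 : ℝ) T)) ∧
      (∀ z : ℝ → H, IsSweepingSolution T C y₀ z →
        (∃ K : ℝ≥0, LipschitzOnWith K z (Icc (0 : ℝ) T)) →
        ∀ t ∈ Icc (0 : ℝ) T, z t = y t) := by
  set p : ℝ → ℝ := fun t => projIcc 0 T hT.le t with hp
  have hpI (t : ℝ) : p t ∈ Icc 0 T := (projIcc 0 T hT.le t).2
  have hp_eq {t : ℝ} (ht : t ∈ Icc 0 T) : p t = t := by simp [hp, projIcc_of_mem hT.le ht]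
  have hp_lip (s t : ℝ) : |p s - p t| ≤ |s - t| := by
    have := (LipschitzWith.projIcc hT.le).dist_le_mul s t
    rwa [NNReal.coe_one, one_mul, Subtype.dist_eq, Real.dist_eq, Real.dist_eq] at this
  have hC (s t : ℝ) (x : H) (hx : x ∈ C (p s)) : ∃ c ∈ C (p t), ‖x - c‖ ≤ L * |s - t| := by
    obtain ⟨v, hv, hmin⟩ := exists_norm_eq_iInf_of_complete_convex (hne _ (hpI t))
      (hclosed _ (hpI t)).isComplete (hconv _ (hpI t)) x
    refine ⟨v, hv, le_trans ?_ (mul_le_mul_of_nonneg_left (hp_lip s t) L.coe_nonneg)⟩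
    rw [← ENNReal.ofReal_le_ofReal_iff (by positivity), ← dist_eq_norm, ← edist_dist]
    refine le_trans (Metric.le_infEDist.2 fun w hw => ?_)
      ((Metric.infEDist_le_hausdorffEDist_of_mem hx).trans (hLip _ (hpI s) _ (hpI t)))
    rw [edist_dist, edist_dist, dist_eq_norm, dist_eq_norm, hmin]
    exact ENNReal.ofReal_le_ofReal
      (ciInf_le ⟨0, forall_mem_range.2 fun _ => norm_nonneg _⟩ (⟨w, hw⟩ : C (p t)))
  obtain ⟨Y, hY0, hYC, hYlip, hYsq⟩ := exists_limit_catchingUp (C := fun t => C (p t))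
    (fun t => hne _ (hpI t)) (fun t => hclosed _ (hpI t)) (fun t => hconv _ (hpI t)) hC
    (y₀ := y₀) (by simpa [hp_eq ⟨le_rfl, hT.le⟩] using hy₀)
  set y : ℝ → H := fun t => Y (p t) with hydef
  have hy_eq {t : ℝ} (ht : t ∈ Icc 0 T) : y t = Y t := congrArg Y (hp_eq ht)
  have hy_lip : LipschitzWith L y := by
    refine LipschitzWith.of_dist_le_mul fun s t => ?_
    rw [dist_eq_norm, Real.dist_eq]
    refine le_trans ?_ (mul_le_mul_of_nonneg_left (hp_lip s t) L.coe_nonneg)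
    rcases le_total (p s) (p t) with h | h
    · rw [abs_sub_comm, abs_of_nonneg (sub_nonneg.2 h)]
      exact hYlip _ _ (hpI s).1 h
    · rw [norm_sub_rev, abs_of_nonneg (sub_nonneg.2 h)]
      exact hYlip _ _ (hpI t).1 h
  have hy_sol : IsSweepingSolution T C y₀ y := by
    refine ⟨by rw [hy_eq ⟨le_rfl, hT.le⟩, hY0], fun t ht => ?_, ?_⟩
    · rw [hy_eq ht]
      simpa only [hp_eq ht] using hYC t ht.1
    · rw [ae_restrict_iff' measurableSet_Icc]
      have hneT : ∀ᵐ t : ℝ, t ≠ T := by simp [ae_iff, measure_singleton]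
      filter_upwards [hy_lip.ae_differentiableAt_of_innerProductSpace, hneT] with t hd htT ht
      refine ⟨deriv y t, hd.hasDerivAt.hasDerivWithinAt, neg_mem_normalCone_of_norm_sub_sq_le
        (A := 2 * (L : ℝ) ^ 2) hd.hasDerivAt (lt_of_le_of_ne ht.2 htT) fun s hs c hc => ?_⟩
      rw [hy_eq ht, hy_eq ⟨ht.1.trans hs.1.le, hs.2.le⟩]
      exact hYsq t s ht.1 hs.1.le c (by simpa only [hp_eq ht] using hc)
  exact ⟨y, ⟨hy_sol, hy_lip.lipschitzOnWith⟩, fun z hz ⟨_, hzK⟩ _ ht =>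
    hy_sol.eq_of_lipschitzOnWith hz hy_lip.lipschitzOnWith hzK ht⟩
end

section
/- Let H be a real Hilbert space and C : H → H a bounded linear operator that is symmetric (⟪C τ₁, τ₂⟫ = ⟪τ₁, C τ₂⟫ for all τ₁, τ₂ ∈ H) and coercive (there is c₀ > 0 with ⟪C τ, τ⟫ ≥ c₀‖τ‖² for all τ ∈ H). Then C is bijective with bounded inverse C⁻¹, and for every closed convex nonempty set 𝒞 ⊆ H and every τ ∈ 𝒞 the normal cone to 𝒞 at τ with respect to the weighted inner product ⟪x, y⟫_{C⁻¹} := ⟪x, C⁻¹ y⟫ equals the image under C of the ordinary normal cone: {y ∈ H : ∀ c ∈ 𝒞, ⟪y, C⁻¹(c − τ)⟫ ≤ 0} = C '' {y ∈ H : ∀ c ∈ 𝒞, ⟪y, c − τ⟫ ≤ 0}. -/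
open RealInnerProductSpace

/-- A bounded, symmetric, coercive linear operator `A` on a real Hilbert space is
bijective with a bounded inverse, and for every closed convex nonempty set `K` and
every `τ ∈ K` the normal cone with respect to the weighted inner product
`⟪x, y⟫_{A⁻¹} = ⟪x, A⁻¹ y⟫` equals the image under `A` of the ordinary normal cone. -/
theorem stmt_6 {H : Type*} [NormedAddCommGroup H] [InnerProductSpace ℝ H] [CompleteSpace H]
    (A : H →L[ℝ] H)
    (hsymm : ∀ τ₁ τ₂ : H, ⟪A τ₁, τ₂⟫ = ⟪τ₁, A τ₂⟫)
    (c₀ : ℝ) (hc₀ : 0 < c₀)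
    (hcoer : ∀ τ : H, c₀ * ‖τ‖ ^ 2 ≤ ⟪A τ, τ⟫) :
    ∃ Ainv : H →L[ℝ] H,
      (∀ x : H, Ainv (A x) = x) ∧ (∀ x : H, A (Ainv x) = x) ∧
      (∀ K : Set H, IsClosed K → Convex ℝ K → K.Nonempty → ∀ τ ∈ K,
        {y : H | ∀ c ∈ K, ⟪y, Ainv (c - τ)⟫ ≤ 0} =
          A '' {y : H | ∀ c ∈ K, ⟪y, c - τ⟫ ≤ 0}) := by
  have hB : IsCoercive ((innerSL ℝ).comp A) :=
    ⟨c₀, hc₀, fun u => by simpa [pow_two, mul_assoc] using hcoer u⟩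
  let e := hB.continuousLinearEquivOfBilin
  have he : ∀ x, e x = A x := fun x =>
    (hB.unique_continuousLinearEquivOfBilin fun w => by simp).symm
  have hleft : ∀ x, e.symm (A x) = x := fun x => by rw [← he, e.symm_apply_apply]
  have hright : ∀ x, A (e.symm x) = x := fun x => by rw [← he, e.apply_symm_apply]
  have hinner : ∀ x z, ⟪A x, e.symm z⟫ = ⟪x, z⟫ := fun x z => by rw [hsymm, hright]
  refine ⟨e.symm, hleft, hright, fun K _ _ _ τ _ => Set.Subset.antisymm ?_ ?_⟩
  · intro y hy
    refine ⟨e.symm y, fun c hc => ?_, hright y⟩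
    rw [← hinner, hright]
    exact hy c hc
  · rintro _ ⟨x, hx, rfl⟩ c hc
    exact (hinner x (c - τ)).trans_le (hx c hc)
end

section
/- Let H be a real Hilbert space, Σ ⊆ H a closed convex bounded nonempty set, V ⊆ H a closed subspace, T > 0 and σ̃ : [0,T] → H a Lipschitz-continuous function. Define the moving set C(t) = (Σ − σ̃(t)) ∩ V and assume that each C(t) is nonempty and that t ↦ C(t) is Lipschitz continuous with respect to the Hausdorff distance. If for every t ∈ [0,T] the set ((interior of Σ) − σ̃(t)) ∩ V is nonempty, then there exists ρ > 0 such that for every t ∈ [0,T] there is a point h_t ∈ C(t) with the open ball of radius ρ centered at h_t contained in Σ − σ̃(t). -/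
open Set
open scoped NNReal ENNReal

/-- Uniform interior ball property for the moving set of an elastoplastic sweeping
process: if `Σ` is closed, convex, bounded and nonempty, `V` is a closed subspace,
`σt` is Lipschitz on `[0, T]`, the moving set `C t = (Σ - σt t) ∩ V` is nonempty and
Lipschitz in the Hausdorff distance, and Slater's condition
`((int Σ) - σt t) ∩ V ≠ ∅` holds for all `t`, then there is a radius `ρ > 0` such that
for every `t` some point `h ∈ C t` has `ball h ρ ⊆ Σ - σt t`. -/
theorem stmt_7 {H : Type*} [NormedAddCommGroup H] [InnerProductSpace ℝ H] [CompleteSpace H]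
    (S : Set H) (hSclosed : IsClosed S) (hSconv : Convex ℝ S)
    (hSbdd : Bornology.IsBounded S) (hSne : S.Nonempty)
    (V : Submodule ℝ H) (hV : IsClosed (V : Set H))
    (T : ℝ) (hT : 0 < T) (σt : ℝ → H) (K : ℝ≥0)
    (hσt : LipschitzOnWith K σt (Icc (0 : ℝ) T))
    (hCne : ∀ t ∈ Icc (0 : ℝ) T, (((fun s => s - σt t) '' S) ∩ (V : Set H)).Nonempty)
    (L : ℝ≥0)
    (hCLip : ∀ t₁ ∈ Icc (0 : ℝ) T, ∀ t₂ ∈ Icc (0 : ℝ) T,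
      EMetric.hausdorffEdist (((fun s => s - σt t₁) '' S) ∩ (V : Set H))
          (((fun s => s - σt t₂) '' S) ∩ (V : Set H))
        ≤ ENNReal.ofReal ((L : ℝ) * |t₁ - t₂|))
    (hSlater : ∀ t ∈ Icc (0 : ℝ) T,
      (((fun s => s - σt t) '' interior S) ∩ (V : Set H)).Nonempty) :
    ∃ ρ : ℝ, 0 < ρ ∧ ∀ t ∈ Icc (0 : ℝ) T,
      ∃ h ∈ ((fun s => s - σt t) '' S) ∩ (V : Set H),
        Metric.ball h ρ ⊆ (fun s => s - σt t) '' S := by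
  have hcont : ContinuousOn σt (Icc (0 : ℝ) T) := hσt.continuousOn
  refine (isCompact_Icc : IsCompact (Icc (0 : ℝ) T)).induction_on
    (p := fun A => ∃ ρ : ℝ, 0 < ρ ∧ ∀ t ∈ A,
      ∃ h ∈ ((fun s => s - σt t) '' S) ∩ (V : Set H),
        Metric.ball h ρ ⊆ (fun s => s - σt t) '' S) ?_ ?_ ?_ ?_
  · exact ⟨1, one_pos, fun t ht => ht.elim⟩
  · rintro A B hAB ⟨ρ, hρ, hB⟩
    exact ⟨ρ, hρ, fun t ht => hB t (hAB ht)⟩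
  · rintro A B ⟨ρ, hρ, hA⟩ ⟨ρ', hρ', hB⟩
    refine ⟨min ρ ρ', lt_min hρ hρ', ?_⟩
    rintro t (ht | ht)
    · obtain ⟨h, hh, hball⟩ := hA t ht
      exact ⟨h, hh, (Metric.ball_subset_ball (min_le_left _ _)).trans hball⟩
    · obtain ⟨h, hh, hball⟩ := hB t ht
      exact ⟨h, hh, (Metric.ball_subset_ball (min_le_right _ _)).trans hball⟩
  · intro t₀ ht₀
    obtain ⟨_, ⟨s₀, hs₀, rfl⟩, hhV⟩ := hSlater t₀ ht₀
    obtain ⟨ε, hε, hεS⟩ := Metric.mem_nhds_iff.1 (mem_interior_iff_mem_nhds.1 hs₀)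
    refine ⟨_, hcont t₀ ht₀ (Metric.ball_mem_nhds (σt t₀) (half_pos hε)),
      ε / 2, half_pos hε, fun t ht => ?_⟩
    have hdist : ‖σt t - σt t₀‖ < ε / 2 := by
      simpa [dist_eq_norm] using ht
    have hball : Metric.ball (s₀ - σt t₀) (ε / 2) ⊆ (fun s => s - σt t) '' S := by
      intro x hx
      refine ⟨x + σt t, hεS ?_, add_sub_cancel_right _ _⟩
      rw [Metric.mem_ball, dist_eq_norm] at hx ⊢
      calc ‖x + σt t - s₀‖ = ‖(x - (s₀ - σt t₀)) + (σt t - σt t₀)‖ := by congr 1; abel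
        _ ≤ ‖x - (s₀ - σt t₀)‖ + ‖σt t - σt t₀‖ := norm_add_le _ _
        _ < ε := by linarith
    exact ⟨s₀ - σt t₀, ⟨hball (Metric.mem_ball_self (half_pos hε)), hhV⟩, hball⟩
end

section
/- Let H be a real Hilbert space, U and V closed subspaces of H that are mutually orthogonal, and K ⊆ H a closed convex set. Let y ∈ K ∩ V, h ∈ V, ρ > 0 be such that the open ball of radius ρ centered at h is contained in K. Let ω ∈ U and d ∈ V be such that ω − d ∈ N_K(y). Then ρ‖ω‖ ≤ ‖d‖ · ‖y − h‖. -/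
open RealInnerProductSpace

/-- Key estimate for selections: let `U, V` be mutually orthogonal closed subspaces of a
real Hilbert space, `K` a closed convex set, `y ∈ K ∩ V`, and `h ∈ V`, `ρ > 0` with the
open ball `B(h, ρ) ⊆ K`. If `ω ∈ U`, `d ∈ V` and `ω - d` lies in the normal cone
`N_K(y)`, then `ρ‖ω‖ ≤ ‖d‖·‖y - h‖`. -/
theorem stmt_8 {H : Type*} [NormedAddCommGroup H] [InnerProductSpace ℝ H] [CompleteSpace H]
    (U V : Submodule ℝ H) (hU : IsClosed (U : Set H)) (hV : IsClosed (V : Set H))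
    (hUV : ∀ u ∈ U, ∀ v ∈ V, ⟪u, v⟫ = 0)
    (K : Set H) (hKclosed : IsClosed K) (hKconv : Convex ℝ K)
    (y : H) (hyK : y ∈ K) (hyV : y ∈ V)
    (h : H) (hhV : h ∈ V) (ρ : ℝ) (hρ : 0 < ρ) (hball : Metric.ball h ρ ⊆ K)
    (ω : H) (hω : ω ∈ U) (d : H) (hd : d ∈ V)
    (hnc : ∀ c ∈ K, ⟪ω - d, c - y⟫ ≤ 0) :
    ρ * ‖ω‖ ≤ ‖d‖ * ‖y - h‖ := by
  rcases eq_or_ne ω 0 with rfl | hω0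
  · rw [norm_zero, mul_zero]
    positivity
  have hpos : 0 < ‖ω‖ := norm_pos_iff.mpr hω0
  rw [← le_div_iff₀ hpos]
  refine le_of_forall_lt_imp_le_of_dense fun r hr => ?_
  rcases lt_or_ge r 0 with hr0 | hr0
  · exact hr0.le.trans (by positivity)
  rw [le_div_iff₀ hpos]
  have hmem : h + (r / ‖ω‖) • ω ∈ K := by
    apply hball
    rw [mem_ball_iff_norm, add_sub_cancel_left, norm_smul, Real.norm_of_nonneg (by positivity),
      div_mul_cancel₀ r hpos.ne']
    exact hr
  have hle := hnc _ hmem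
  have hωhy : ⟪ω, h - y⟫ = 0 := hUV ω hω _ (V.sub_mem hhV hyV)
  have hdω : ⟪d, ω⟫ = 0 := by rw [real_inner_comm, hUV ω hω d hd]
  rw [add_sub_right_comm, inner_sub_left, inner_add_right, inner_add_right, inner_smul_right,
    inner_smul_right, hωhy, hdω, real_inner_self_eq_norm_sq] at hle
  have hscale : r / ‖ω‖ * ‖ω‖ ^ 2 = r * ‖ω‖ := by field_simp
  have hcs : ⟪d, h - y⟫ ≤ ‖d‖ * ‖y - h‖ := by
    rw [norm_sub_rev y h]
    exact real_inner_le_norm d (h - y)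
  linarith
end

section
/- Let H be a real Hilbert space, C₁, C₂ ⊆ H closed convex nonempty sets, x ∈ C₁ ∩ C₂ and v ∈ N_{C₁ ∩ C₂}(x). Then v ∈ N_{C₁}(x) + N_{C₂}(x) (Minkowski sum) if and only if strong duality holds, i.e. there exists y* ∈ H such that δ*_{C₁}(y*) + δ*_{C₂}(v − y*) = δ*_{C₁ ∩ C₂}(v) (equality in the extended reals; by weak duality this y* then attains the infimum of y ↦ δ*_{C₁}(y) + δ*_{C₂}(v − y), and this infimum equals δ*_{C₁ ∩ C₂}(v)). -/
open RealInnerProductSpace Pointwise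

/-- The support function of a set `C`, with values in the extended reals. -/
noncomputable def suppFn {H : Type*} [NormedAddCommGroup H] [InnerProductSpace ℝ H]
    (C : Set H) (y : H) : EReal :=
  ⨆ c ∈ C, ((⟪y, c⟫ : ℝ) : EReal)

section SupportFunction

variable {H : Type*} [NormedAddCommGroup H] [InnerProductSpace ℝ H] {C : Set H} {x y : H}

lemma inner_le_suppFn {c : H} (hc : c ∈ C) (y : H) : ((⟪y, c⟫ : ℝ) : EReal) ≤ suppFn C y :=
  le_iSup₂ (f := fun c (_ : c ∈ C) => ((⟪y, c⟫ : ℝ) : EReal)) c hc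

lemma suppFn_eq_inner_of_mem_normalCone (hx : x ∈ C) (hy : y ∈ normalCone C x) :
    suppFn C y = ((⟪y, x⟫ : ℝ) : EReal) := by
  refine le_antisymm (iSup₂_le fun c hc => ?_) (inner_le_suppFn hx y)
  have h := hy c hc
  rw [inner_sub_right] at h
  exact EReal.coe_le_coe_iff.2 (by linarith)

end SupportFunction

/-- For `x ∈ C₁ ∩ C₂` and `v ∈ N_{C₁ ∩ C₂}(x)`: `v` belongs to the Minkowski sum
`N_{C₁}(x) + N_{C₂}(x)` iff strong duality holds, i.e. iff there exists `y*` with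
`δ*_{C₁}(y*) + δ*_{C₂}(v - y*) = δ*_{C₁ ∩ C₂}(v)` in the extended reals. -/
theorem stmt_10 {H : Type*} [NormedAddCommGroup H] [InnerProductSpace ℝ H] [CompleteSpace H]
    (C₁ C₂ : Set H) (hC₁closed : IsClosed C₁) (hC₁conv : Convex ℝ C₁) (hC₁ne : C₁.Nonempty)
    (hC₂closed : IsClosed C₂) (hC₂conv : Convex ℝ C₂) (hC₂ne : C₂.Nonempty)
    (x : H) (hx : x ∈ C₁ ∩ C₂) (v : H) (hv : v ∈ normalCone (C₁ ∩ C₂) x) :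
    v ∈ normalCone C₁ x + normalCone C₂ x ↔
      ∃ ystar : H, suppFn C₁ ystar + suppFn C₂ (v - ystar) = suppFn (C₁ ∩ C₂) v := by
  rw [suppFn_eq_inner_of_mem_normalCone hx hv]
  constructor
  · rintro ⟨y₁, h₁, y₂, h₂, rfl⟩
    refine ⟨y₁, ?_⟩
    dsimp only
    rw [add_sub_cancel_left, suppFn_eq_inner_of_mem_normalCone hx.1 h₁,
      suppFn_eq_inner_of_mem_normalCone hx.2 h₂, inner_add_left, EReal.coe_add]
  · rintro ⟨y, hy⟩
    have key : ∀ c₁ ∈ C₁, ∀ c₂ ∈ C₂, ⟪y, c₁⟫ + ⟪v - y, c₂⟫ ≤ ⟪v, x⟫ := fun c₁ h₁ c₂ h₂ => by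
      have h := (add_le_add (inner_le_suppFn h₁ y) (inner_le_suppFn h₂ (v - y))).trans hy.le
      exact_mod_cast h
    have hvx : ⟪v - y, x⟫ = ⟪v, x⟫ - ⟪y, x⟫ := inner_sub_left v y x
    refine ⟨y, fun c hc => ?_, v - y, fun c hc => ?_, add_sub_cancel y v⟩
    · have h := key c hc x hx.2
      rw [inner_sub_right]
      linarith
    · have h := key x hx.1 c hc
      rw [inner_sub_right]
      linarith
end

section
/- Slater's constraint qualification II: let H be a real Hilbert space and C₁, C₂ ⊆ H closed convex nonempty sets such that 0 belongs to the interior of the Minkowski difference C₁ − C₂ = {c₁ − c₂ : c₁ ∈ C₁, c₂ ∈ C₂}. Then for every x ∈ C₁ ∩ C₂ the additivity of normal cones holds: N_{C₁}(x) + N_{C₂}(x) = N_{C₁ ∩ C₂}(x). -/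
open RealInnerProductSpace Pointwise

/-- In a Hilbert space, a decreasing sequence of nonempty closed convex sets whose first term is
bounded has nonempty intersection. -/
theorem exists_forall_mem_of_antitone_isClosed_convex {H : Type*} [NormedAddCommGroup H]
    [InnerProductSpace ℝ H] [CompleteSpace H] {S : ℕ → Set H} (hanti : Antitone S)
    (hclosed : ∀ n, IsClosed (S n)) (hconv : ∀ n, Convex ℝ (S n)) (hne : ∀ n, (S n).Nonempty)
    (hbdd : Bornology.IsBounded (S 0)) : ∃ a, ∀ n, a ∈ S n := by
  have hproj : ∀ n, ∃ a ∈ S n, ∀ w ∈ S n, 0 ≤ ⟪a, w - a⟫ := by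
    intro n
    obtain ⟨a, ha, h⟩ :=
      exists_norm_eq_iInf_of_complete_convex (hne n) (hclosed n).isComplete (hconv n) 0
    refine ⟨a, ha, fun w hw ↦ ?_⟩
    have := (norm_eq_iInf_iff_real_inner_le_zero (hconv n) ha).1 h w hw
    rw [zero_sub, inner_neg_left] at this
    linarith
  choose a ha hproj using hproj
  have hdist : ∀ n m, n ≤ m → ‖a m - a n‖ ^ 2 ≤ ‖a m‖ ^ 2 - ‖a n‖ ^ 2 := by
    intro n m hnm
    have h1 := hproj n (a m) (hanti hnm (ha m))
    have h2 := norm_add_sq_real (a n) (a m - a n)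
    rw [add_sub_cancel] at h2
    linarith
  have hmono : Monotone fun n ↦ ‖a n‖ ^ 2 := fun n m hnm ↦ by
    have := hdist n m hnm
    have := sq_nonneg ‖a m - a n‖
    dsimp only
    linarith
  obtain ⟨M, hM⟩ := hbdd.exists_norm_le
  have hbdd' : BddAbove (Set.range fun n ↦ ‖a n‖ ^ 2) := by
    refine ⟨M ^ 2, ?_⟩
    rintro _ ⟨n, rfl⟩
    have := hM (a n) (hanti (Nat.zero_le n) (ha n))
    dsimp only
    gcongr
  have hcauchy := (tendsto_atTop_ciSup hmono hbdd').cauchySeq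
  have hcauchy' : CauchySeq a := by
    rw [Metric.cauchySeq_iff'] at hcauchy ⊢
    intro ε hε
    obtain ⟨N, hN⟩ := hcauchy (ε ^ 2) (by positivity)
    refine ⟨N, fun n hn ↦ ?_⟩
    have h1 := hN n hn
    rw [Real.dist_eq] at h1
    rw [dist_eq_norm]
    exact lt_of_pow_lt_pow_left₀ 2 hε.le
      ((hdist N n hn).trans_lt ((le_abs_self _).trans_lt h1))
  obtain ⟨b, hb⟩ := cauchySeq_tendsto_of_complete hcauchy'
  refine ⟨b, fun n ↦ (hclosed n).mem_of_tendsto hb ?_⟩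
  filter_upwards [Filter.eventually_ge_atTop n] with m hm
  exact hanti hm (ha m)

/-- In a Hilbert space, the difference of a bounded closed convex set and a closed convex set is
closed. -/
theorem isClosed_sub_of_convex_of_isBounded {H : Type*} [NormedAddCommGroup H]
    [InnerProductSpace ℝ H] [CompleteSpace H] {A B : Set H} (hA : IsClosed A)
    (hAconv : Convex ℝ A) (hAbdd : Bornology.IsBounded A) (hB : IsClosed B)
    (hBconv : Convex ℝ B) : IsClosed (A - B) := by
  refine isClosed_of_closure_subset fun p hp ↦ ?_
  let S : ℕ → Set H := fun n ↦
    A ∩ (fun a ↦ a - p) ⁻¹' Metric.cthickening (1 / ((n : ℝ) + 1)) B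
  obtain ⟨a, ha⟩ : ∃ a, ∀ n, a ∈ S n := by
    refine exists_forall_mem_of_antitone_isClosed_convex ?_ ?_ ?_ ?_ ?_
    · intro n m hnm
      refine Set.inter_subset_inter_right _ (Set.preimage_mono (Metric.cthickening_mono ?_ _))
      exact one_div_le_one_div_of_le (by positivity) (by gcongr)
    · exact fun n ↦ hA.inter (Metric.isClosed_cthickening.preimage (by fun_prop))
    · intro n
      refine hAconv.inter ?_
      simpa only [sub_eq_add_neg] using (hBconv.cthickening _).translate_preimage_left (-p)
    · intro n
      obtain ⟨_, ⟨a, ha, b, hb, rfl⟩, hab⟩ :=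
        Metric.mem_closure_iff.1 hp (1 / ((n : ℝ) + 1)) (by positivity)
      refine ⟨a, ha, Metric.mem_cthickening_of_dist_le _ b _ _ hb ?_⟩
      rw [dist_comm, dist_eq_norm] at hab
      rw [dist_eq_norm, sub_right_comm]
      exact hab.le
    · exact hAbdd.subset Set.inter_subset_left
  have hmem : a - p ∈ B := by
    rw [← hB.closure_eq, Metric.closure_eq_iInter_cthickening' B
      (Set.range fun n : ℕ ↦ 1 / ((n : ℝ) + 1))]
    · simpa using fun n ↦ (ha n).2
    · intro ε hε
      obtain ⟨n, hn⟩ := exists_nat_one_div_lt hε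
      exact ⟨_, ⟨n, rfl⟩, by positivity, hn.le⟩
  exact ⟨a, (ha 0).1, a - p, hmem, sub_sub_cancel a p⟩

/-- In a Hilbert space, if the difference of two closed convex sets has nonempty interior, then
so does the difference of the first set truncated to some ball and the second set. -/
theorem exists_nonempty_interior_inter_closedBall_sub {H : Type*} [NormedAddCommGroup H]
    [InnerProductSpace ℝ H] [CompleteSpace H] {A B : Set H} (hA : IsClosed A)
    (hAconv : Convex ℝ A) (hB : IsClosed B) (hBconv : Convex ℝ B)
    (hint : (interior (A - B)).Nonempty) (x : H) :
    ∃ n : ℕ, (interior (A ∩ Metric.closedBall x n - B)).Nonempty := by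
  have hclosed : ∀ n : ℕ, IsClosed ((A ∩ Metric.closedBall x n - B) ∪ (interior (A - B))ᶜ) :=
    fun n ↦ (isClosed_sub_of_convex_of_isBounded (hA.inter Metric.isClosed_closedBall)
      (hAconv.inter (convex_closedBall x n))
      (Metric.isBounded_closedBall.subset Set.inter_subset_right) hB hBconv).union
      isOpen_interior.isClosed_compl
  have hunion : ⋃ n : ℕ, ((A ∩ Metric.closedBall x n - B) ∪ (interior (A - B))ᶜ) = Set.univ := by
    refine Set.eq_univ_of_forall fun u ↦ Set.mem_iUnion.2 ?_
    by_cases hu : u ∈ interior (A - B)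
    · obtain ⟨a, ha, b, hb, rfl⟩ := interior_subset hu
      obtain ⟨n, hn⟩ := exists_nat_ge (dist a x)
      exact ⟨n, Or.inl ⟨a, ⟨ha, hn⟩, b, hb, rfl⟩⟩
    · exact ⟨0, Or.inr hu⟩
  obtain ⟨u, hu, hu'⟩ :=
    (dense_iUnion_interior_of_closed hclosed hunion).inter_open_nonempty _ isOpen_interior hint
  obtain ⟨n, hn⟩ := Set.mem_iUnion.1 hu'
  refine ⟨n, u, mem_interior.2 ⟨_, ?_, isOpen_interior.inter isOpen_interior, hu, hn⟩⟩
  rintro v ⟨hv, hv'⟩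
  exact (interior_subset hv').resolve_right (not_not_intro hv)

/-- Slater's constraint qualification II: if `0` lies in the interior of the Minkowski
difference `C₁ - C₂`, then the additivity of normal cones holds at every point of
`C₁ ∩ C₂`. -/
theorem stmt_11 {H : Type*} [NormedAddCommGroup H] [InnerProductSpace ℝ H] [CompleteSpace H]
    (C₁ C₂ : Set H) (hC₁closed : IsClosed C₁) (hC₁conv : Convex ℝ C₁) (hC₁ne : C₁.Nonempty)
    (hC₂closed : IsClosed C₂) (hC₂conv : Convex ℝ C₂) (hC₂ne : C₂.Nonempty)
    (h0 : (0 : H) ∈ interior (C₁ - C₂)) :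
    ∀ x ∈ C₁ ∩ C₂, normalCone C₁ x + normalCone C₂ x = normalCone (C₁ ∩ C₂) x := by
  rintro x ⟨hx₁, hx₂⟩
  refine Set.Subset.antisymm ?_ fun y hy ↦ ?_
  · rintro _ ⟨y, hy, z, hz, rfl⟩ c ⟨hc₁, hc₂⟩
    rw [inner_add_left]
    exact add_nonpos (hy c hc₁) (hz c hc₂)
  let E : Set (H × ℝ) := {p | ∃ c₁ ∈ C₁, ∃ c₂ ∈ C₂, p.1 = c₁ - c₂ ∧ p.2 ≤ ⟪y, c₁ - x⟫}
  have hEconv : Convex ℝ E := by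
    rintro ⟨u, r⟩ ⟨c₁, hc₁, c₂, hc₂, rfl, hr⟩ ⟨v, s⟩ ⟨d₁, hd₁, d₂, hd₂, rfl, hs⟩ a b ha hb hab
    refine ⟨a • c₁ + b • d₁, hC₁conv hc₁ hd₁ ha hb hab, a • c₂ + b • d₂,
      hC₂conv hc₂ hd₂ ha hb hab, ?_, ?_⟩
    · simp only [Prod.fst_add, Prod.smul_fst]
      module
    · have hx : a • c₁ + b • d₁ - x = a • (c₁ - x) + b • (d₁ - x) := by
        obtain rfl : b = 1 - a := by linarith
        module
      simp only [Prod.snd_add, Prod.smul_snd, smul_eq_mul, hx, inner_add_right,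
        real_inner_smul_right] at hr hs ⊢
      gcongr
  have hEint : (interior E).Nonempty := by
    obtain ⟨n, u, hu⟩ := exists_nonempty_interior_inter_closedBall_sub hC₁closed hC₁conv
      hC₂closed hC₂conv ⟨0, h0⟩ x
    have hsub : interior (C₁ ∩ Metric.closedBall x n - C₂) ×ˢ Set.Iio (-(‖y‖ * n)) ⊆ E := by
      rintro ⟨v, r⟩ ⟨hv, hr⟩
      obtain ⟨c₁, ⟨hc₁, hc₁'⟩, c₂, hc₂, hv⟩ := interior_subset hv
      refine ⟨c₁, hc₁, c₂, hc₂, hv.symm, (Set.mem_Iio.1 hr).le.trans ?_⟩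
      rw [Metric.mem_closedBall, dist_eq_norm] at hc₁'
      refine (neg_le_neg ?_).trans (neg_le_of_abs_le (abs_real_inner_le_norm y (c₁ - x)))
      gcongr
    exact ⟨(u, -(‖y‖ * n) - 1), interior_maximal hsub (isOpen_interior.prod isOpen_Iio)
      ⟨hu, by simp⟩⟩
  have h0E : (0 : H × ℝ) ∉ interior E := by
    intro h
    have hcont : Filter.Tendsto (fun t : ℝ ↦ ((0 : H), t)) (nhdsWithin 0 (Set.Ioi 0))
        (nhds (0 : H × ℝ)) :=
      ((Continuous.prodMk_right (0 : H)).tendsto (0 : ℝ)).mono_left nhdsWithin_le_nhds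
    obtain ⟨t, ⟨c₁, hc₁, c₂, hc₂, heq, ht⟩, ht0⟩ :=
      ((hcont.eventually (mem_interior_iff_mem_nhds.1 h)).and self_mem_nhdsWithin).exists
    obtain rfl : c₁ = c₂ := sub_eq_zero.1 heq.symm
    exact absurd (ht.trans (hy c₁ ⟨hc₁, hc₂⟩)) (not_le.2 ht0)
  obtain ⟨f, hf, hfE⟩ := geometric_hahn_banach_of_nonempty_interior_point hEconv h0E hEint
  set α : ℝ := f (0, 1)
  set z : H := (InnerProductSpace.toDual ℝ H).symm (f.comp (ContinuousLinearMap.inl ℝ H ℝ)) with hz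
  have hfapply : ∀ v r, f (v, r) = ⟪z, v⟫ + r * α := by
    intro v r
    have : ((v, r) : H × ℝ) = (v, 0) + r • (0, 1) := by simp
    rw [this, map_add, map_smul, smul_eq_mul, hz, InnerProductSpace.toDual_symm_apply]
    rfl
  have hineq : ∀ c₁ ∈ C₁, ∀ c₂ ∈ C₂, ∀ r ≤ ⟪y, c₁ - x⟫, ⟪z, c₁ - c₂⟫ + r * α ≤ 0 := by
    intro c₁ hc₁ c₂ hc₂ r hr
    rw [← hfapply]
    exact (hfE _ ⟨c₁, hc₁, c₂, hc₂, rfl, hr⟩).trans_eq (map_zero f)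
  have hα0 : 0 ≤ α := by
    have := hineq x hx₁ x hx₂ (-1) (by simp)
    simp only [sub_self, inner_zero_right] at this
    linarith
  have hαne : α ≠ 0 := by
    intro hα0
    have hcont : Filter.Tendsto (fun t : ℝ ↦ t • z) (nhdsWithin 0 (Set.Ioi 0)) (nhds (0 : H)) := by
      have hc : Continuous fun t : ℝ ↦ t • z := by fun_prop
      simpa only [zero_smul] using (hc.tendsto 0).mono_left nhdsWithin_le_nhds
    obtain ⟨t, ⟨c₁, hc₁, c₂, hc₂, heq⟩, ht0⟩ :=
      ((hcont.eventually (mem_interior_iff_mem_nhds.1 h0)).and self_mem_nhdsWithin).exists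
    have h := hineq c₁ hc₁ c₂ hc₂ _ le_rfl
    have heq' : c₁ - c₂ = t • z := heq
    rw [hα0, mul_zero, add_zero, heq', real_inner_smul_right, real_inner_self_eq_norm_sq] at h
    have hz0 : z = 0 := by
      by_contra hne
      have : 0 < t * ‖z‖ ^ 2 := mul_pos ht0 (by positivity)
      linarith
    refine hf (ContinuousLinearMap.ext fun p ↦ ?_)
    rw [← Prod.mk.eta (p := p), hfapply, hz0, hα0]
    simp
  have hαpos : 0 < α := lt_of_le_of_ne hα0 (Ne.symm hαne)
  refine ⟨y + α⁻¹ • z, fun c hc ↦ ?_, -(α⁻¹ • z), fun c hc ↦ ?_, by simp⟩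
  · have h := mul_nonpos_of_nonneg_of_nonpos (inv_nonneg.2 hα0) (hineq c hc x hx₂ _ le_rfl)
    rw [inner_add_left, real_inner_smul_left]
    calc ⟪y, c - x⟫ + α⁻¹ * ⟪z, c - x⟫ = α⁻¹ * (⟪z, c - x⟫ + ⟪y, c - x⟫ * α) := by
          field_simp
          ring
      _ ≤ 0 := h
  · have h := mul_nonpos_of_nonneg_of_nonpos (inv_nonneg.2 hα0)
      (hineq x hx₁ c hc 0 (by simp))
    rw [zero_mul, add_zero, ← neg_sub, inner_neg_right] at h
    rw [inner_neg_left, real_inner_smul_left]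
    linarith
end

section
/- Attouch–Brezis constraint qualification: let H be a real Hilbert space and C₁, C₂ ⊆ H closed convex nonempty sets such that the cone {λ(c₁ − c₂) : λ ≥ 0, c₁ ∈ C₁, c₂ ∈ C₂} is a closed linear subspace of H. Then for every x ∈ C₁ ∩ C₂ the additivity of normal cones holds: N_{C₁}(x) + N_{C₂}(x) = N_{C₁ ∩ C₂}(x). -/
open RealInnerProductSpace Pointwise

theorem Convex.mem_of_hasSum_geometric {E : Type*} [NormedAddCommGroup E] [NormedSpace ℝ E]
    {S : Set E} (hS : Convex ℝ S) (hc : IsClosed S) (h0 : 0 ∈ S) {s : ℕ → E}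
    (hs : ∀ n, s n ∈ S) {a : E} (ha : HasSum (fun n => (1 / 2 : ℝ) ^ (n + 1) • s n) a) :
    a ∈ S := by
  have key : ∀ n, ∀ s : ℕ → E, (∀ n, s n ∈ S) →
      ∑ k ∈ Finset.range n, (1 / 2 : ℝ) ^ (k + 1) • s k ∈ S := by
    intro n
    induction n with
    | zero => intro s _; simpa using h0
    | succ n ih =>
      intro s hs
      have h1 := hS (ih (fun k => s (k + 1)) fun k => hs _) (hs 0)
        (a := 1 / 2) (b := 1 / 2) (by norm_num) (by norm_num) (by norm_num)
      rw [Finset.sum_range_succ']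
      convert h1 using 2
      · rw [Finset.smul_sum]
        refine Finset.sum_congr rfl fun k _ => ?_
        rw [smul_smul, pow_succ' _ (k + 1)]
      · simp
  exact hc.mem_of_tendsto ha.tendsto_sum_nat (Filter.Eventually.of_forall fun n => key n s hs)

theorem Convex.closure_mem_nhds_zero_of_absorbing {E : Type*} [NormedAddCommGroup E]
    [NormedSpace ℝ E] [CompleteSpace E] {D : Set E} (hD : Convex ℝ D) (h0 : 0 ∈ D)
    (habs : ∀ w : E, ∃ n : ℕ, ∃ d ∈ D, w = (n : ℝ) • d) :
    closure D ∈ nhds (0 : E) := by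
  have hint : (interior (closure D)).Nonempty := by
    obtain ⟨n, hn⟩ := nonempty_interior_of_iUnion_of_closed
      (f := fun n : ℕ => closure (((n : ℝ) + 1) • D)) (fun n => isClosed_closure) (by
        refine Set.eq_univ_of_forall fun w => ?_
        obtain ⟨n, d, hd, rfl⟩ := habs w
        refine Set.mem_iUnion.2 ⟨n, subset_closure ⟨((n : ℝ) / (n + 1)) • d,
          hD.smul_mem_of_zero_mem h0 hd
            ⟨by positivity, by rw [div_le_one (by positivity)]; linarith⟩, ?_⟩⟩
        simp only [smul_smul]
        congr 1
        field_simp)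
    have hn0 : ((n : ℝ) + 1) ≠ 0 := by positivity
    rw [closure_smul₀' hn0, interior_smul₀ hn0] at hn
    exact Set.smul_set_nonempty.1 hn
  obtain ⟨w, hw⟩ := hint
  obtain ⟨n, d, hd, hwd⟩ := habs (-w)
  have h := hD.closure.combo_interior_self_mem_interior hw (subset_closure hd)
    (a := 1 / (n + 1)) (b := n / (n + 1)) (by positivity) (by positivity) (by field_simp; ring)
  have hcomb : (1 / (n + 1) : ℝ) • w + (n / (n + 1) : ℝ) • d = 0 := by
    rw [div_eq_inv_mul (n : ℝ), mul_smul _ (n : ℝ) d, ← hwd]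
    simp
  rw [hcomb] at h
  exact mem_interior_iff_mem_nhds.1 h

theorem exists_ball_subset_sub_of_absorbing {H : Type*} [NormedAddCommGroup H] [NormedSpace ℝ H]
    [CompleteSpace H] {S T : Set H} (hS : Convex ℝ S) (hSc : IsClosed S) (hS0 : 0 ∈ S)
    (hS1 : ∀ s ∈ S, ‖s‖ ≤ 1) (hT : Convex ℝ T) (hTc : IsClosed T) (hT0 : 0 ∈ T)
    (hT1 : ∀ t ∈ T, ‖t‖ ≤ 1) (W : Submodule ℝ H) [CompleteSpace W]
    (habs : ∀ w ∈ W, ∃ n : ℕ, ∃ s ∈ S, ∃ t ∈ T, s - t ∈ W ∧ w = (n : ℝ) • (s - t)) :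
    ∃ δ > 0, ∀ w ∈ W, ‖w‖ < δ → ∃ s ∈ S, ∃ t ∈ T, w = s - t := by
  have hD : Convex ℝ (W.subtype ⁻¹' (S - T)) := (hS.sub hT).linear_preimage W.subtype
  have hcl := hD.closure_mem_nhds_zero_of_absorbing ⟨0, hS0, 0, hT0, by simp⟩ (fun w => by
    obtain ⟨n, s, hs, t, ht, hst, hw⟩ := habs w w.2
    exact ⟨n, ⟨s - t, hst⟩, ⟨s, hs, t, ht, rfl⟩, Subtype.ext hw⟩)
  obtain ⟨δ, hδ, hball⟩ := Metric.mem_nhds_iff.1 hcl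
  have step : ∀ z : Metric.ball (0 : W) δ, ∃ z' : Metric.ball (0 : W) δ, ∃ s ∈ S, ∃ t ∈ T,
      ((z' : W) : H) = (2 : ℝ) • (((z : W) : H) - (s - t)) := by
    intro z
    obtain ⟨d, ⟨s, hs, t, ht, hd⟩, hzd⟩ :=
      Metric.mem_closure_iff.1 (hball z.2) (δ / 2) (by positivity)
    refine ⟨⟨(2 : ℝ) • ((z : W) - d), ?_⟩, s, hs, t, ht, ?_⟩
    · rw [dist_eq_norm] at hzd
      rw [mem_ball_zero_iff, norm_smul, Real.norm_two]
      linarith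
    · simp only [Submodule.coe_smul, Submodule.coe_sub]
      rw [show (d : H) = s - t from hd.symm]
  choose next s hs t ht hnext using step
  refine ⟨δ / 2, by positivity, fun w hw hwδ => ?_⟩
  let z : ℕ → Metric.ball (0 : W) δ := fun n => next^[n] ⟨(2 : ℝ) • ⟨w, hw⟩, by
    rw [mem_ball_zero_iff, norm_smul, Real.norm_two, Submodule.coe_norm]
    change 2 * ‖w‖ < δ
    linarith⟩
  have hz : ∀ n, ((z (n + 1) : W) : H) = (2 : ℝ) • (((z n : W) : H) - (s (z n) - t (z n))) := by
    intro n
    rw [← hnext]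
    simp only [z, Function.iterate_succ_apply']
  have hsummable : ∀ u : ℕ → H, (∀ n, ‖u n‖ ≤ 1) →
      Summable fun n => (1 / 2 : ℝ) ^ (n + 1) • u n := by
    intro u hu
    refine Summable.of_norm_bounded (g := fun n => (1 / 2 : ℝ) ^ (n + 1))
      ((summable_nat_add_iff 1).2 summable_geometric_two) fun n => ?_
    rw [norm_smul, norm_pow]
    have := mul_le_mul_of_nonneg_left (hu n) (by positivity : 0 ≤ ‖(1 / 2 : ℝ)‖ ^ (n + 1))
    simpa using this
  obtain ⟨a, ha⟩ := hsummable (fun n => s (z n)) fun n => hS1 _ (hs _)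
  obtain ⟨b, hb⟩ := hsummable (fun n => t (z n)) fun n => hT1 _ (ht _)
  refine ⟨a, hS.mem_of_hasSum_geometric hSc hS0 (fun n => hs _) ha,
    b, hT.mem_of_hasSum_geometric hTc hT0 (fun n => ht _) hb, ?_⟩
  have hpartial : ∀ n, ∑ k ∈ Finset.range n,
      ((1 / 2 : ℝ) ^ (k + 1) • s (z k) - (1 / 2 : ℝ) ^ (k + 1) • t (z k)) =
      w - (1 / 2 : ℝ) ^ (n + 1) • ((z n : W) : H) := by
    intro n
    induction n with
    | zero => simp [z, smul_smul]
    | succ n ih =>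
      rw [Finset.sum_range_succ, ih, hz n]
      module
  have hlim : Filter.Tendsto (fun n => w - (1 / 2 : ℝ) ^ (n + 1) • ((z n : W) : H))
      Filter.atTop (nhds w) := by
    have h0 : Filter.Tendsto (fun n => (1 / 2 : ℝ) ^ (n + 1) • ((z n : W) : H))
        Filter.atTop (nhds 0) := by
      refine squeeze_zero_norm (a := fun n => (1 / 2 : ℝ) ^ (n + 1) * δ) (fun n => ?_) ?_
      · have hn : ‖((z n : W) : H)‖ ≤ δ := (mem_ball_zero_iff.1 (z n).2).le
        rw [norm_smul, norm_pow, Real.norm_of_nonneg (by norm_num : (0 : ℝ) ≤ 1 / 2)]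
        gcongr
      · simpa using ((Filter.tendsto_add_atTop_iff_nat 1).2
          (tendsto_pow_atTop_nhds_zero_of_lt_one (r := (1 / 2 : ℝ)) (by norm_num)
            (by norm_num))).mul_const δ
    simpa using h0.const_sub w
  have hsum := (ha.sub hb).tendsto_sum_nat
  simp only [hpartial] at hsum
  exact tendsto_nhds_unique hlim hsum

/-- A functional that is nonpositive on `A ∩ B` splits once `A - B` contains, with bounded
representatives, a neighbourhood of the origin of a subspace containing it. -/
theorem exists_inner_le_of_ball_subset_sub {H : Type*} [NormedAddCommGroup H]
    [InnerProductSpace ℝ H] {A B : Set H} (hA : Convex ℝ A) (hB : Convex ℝ B)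
    (W : Submodule ℝ H) [CompleteSpace W] (hAB : ∀ a ∈ A, ∀ b ∈ B, a - b ∈ W)
    {δ : ℝ} (hδ : 0 < δ)
    (hball : ∀ w ∈ W, ‖w‖ < δ → ∃ a ∈ A, ∃ b ∈ B, ‖a‖ ≤ 1 ∧ w = a - b)
    {y : H} (hy : ∀ c ∈ A ∩ B, ⟪y, c⟫ ≤ 0) :
    ∃ p : H, ∀ a ∈ A, ∀ b ∈ B, ⟪y, a⟫ ≤ ⟪p, a - b⟫ := by
  let E : Set (W × ℝ) := {q | ∃ a ∈ A, ∃ b ∈ B, (q.1 : H) = a - b ∧ -⟪y, a⟫ ≤ q.2}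
  have hE : Convex ℝ E := by
    rintro ⟨w, r⟩ ⟨a, ha, b, hb, hw, hr⟩ ⟨w', r'⟩ ⟨a', ha', b', hb', hw', hr'⟩ u v hu hv huv
    refine ⟨u • a + v • a', hA ha ha' hu hv huv, u • b + v • b', hB hb hb' hu hv huv, ?_, ?_⟩
    · simp only at hw hw'
      simp only [Prod.smul_mk, Prod.mk_add_mk, Submodule.coe_add, Submodule.coe_smul, hw, hw']
      module
    · simp only [Prod.smul_mk, Prod.mk_add_mk, inner_add_right, inner_smul_right, smul_eq_mul]
      simp only at hr hr'
      nlinarith [mul_le_mul_of_nonneg_left hr hu, mul_le_mul_of_nonneg_left hr' hv]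
  have hint : ((0 : W), ‖y‖ + 1) ∈ interior E := by
    rw [mem_interior_iff_mem_nhds]
    filter_upwards [prod_mem_nhds (Metric.ball_mem_nhds (0 : W) hδ)
      (Ioi_mem_nhds (show ‖y‖ < ‖y‖ + 1 by linarith))]
    rintro ⟨w, r⟩ ⟨hw, hr⟩
    obtain ⟨a, ha, b, hb, ha1, hab⟩ := hball w w.2 (mem_ball_zero_iff.1 hw)
    refine ⟨a, ha, b, hb, hab, ?_⟩
    have h1 := (abs_le.1 (abs_real_inner_le_norm y a)).1
    have h2 := mul_le_mul_of_nonneg_left ha1 (norm_nonneg y)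
    have h3 : ‖y‖ < r := hr
    change -⟪y, a⟫ ≤ r
    linarith
  have h0 : (0 : W × ℝ) ∉ interior E := by
    intro h
    have hlim : Filter.Tendsto (fun r : ℝ => ((0 : W), r)) (nhds 0) (nhds (0 : W × ℝ)) :=
      (Continuous.prodMk_right (0 : W)).tendsto 0
    obtain ⟨ε, hε, hεE⟩ := Metric.mem_nhds_iff.1 (hlim (mem_interior_iff_mem_nhds.1 h))
    obtain ⟨a, ha, b, hb, hab, hr⟩ := hεE (show -(ε / 2) ∈ Metric.ball (0 : ℝ) ε by
      rw [mem_ball_zero_iff, norm_neg, Real.norm_of_nonneg (by positivity)]; linarith)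
    have hab' : a = b := (sub_eq_zero.1 (by simpa using hab.symm))
    have := hy a ⟨ha, hab' ▸ hb⟩
    simp only at hr
    linarith
  obtain ⟨f, hf⟩ := geometric_hahn_banach_point_open hE.interior isOpen_interior h0
  rw [map_zero] at hf
  have hfE : ∀ q ∈ E, 0 ≤ f q := by
    intro q hq
    have hcl : closure (interior E) ⊆ {q | 0 ≤ f q} :=
      closure_minimal (fun q hq => (hf q hq).le) (isClosed_le continuous_const f.continuous)
    rw [hE.closure_interior_eq_closure_of_nonempty_interior ⟨_, hint⟩] at hcl
    exact hcl (subset_closure hq)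
  let g : W →L[ℝ] ℝ := f.comp (ContinuousLinearMap.inl ℝ W ℝ)
  have hfg : ∀ w r, f (w, r) = g w + r * f (0, 1) := by
    intro w r
    have : ((w, r) : W × ℝ) = (w, 0) + r • (0, 1) := by simp
    rw [this, map_add, map_smul]
    rfl
  have hs : 0 < f (0, 1) := by
    have h := hf _ hint
    rw [hfg, map_zero, zero_add] at h
    exact pos_of_mul_pos_right h (by positivity)
  let q : W := (InnerProductSpace.toDual ℝ W).symm g
  have hq : ∀ w : W, g w = ⟪(q : H), (w : H)⟫ := by
    intro w
    rw [← Submodule.coe_inner]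
    exact (InnerProductSpace.toDual_symm_apply).symm
  refine ⟨(f (0, 1))⁻¹ • (q : H), fun a ha b hb => ?_⟩
  have h := hfE (⟨a - b, hAB a ha b hb⟩, -⟪y, a⟫) ⟨a, ha, b, hb, rfl, le_rfl⟩
  rw [hfg, hq] at h
  rw [real_inner_smul_left, ← div_eq_inv_mul, le_div_iff₀ hs]
  linarith

/-- Attouch–Brezis constraint qualification: if the cone
`{λ(c₁ - c₂) : λ ≥ 0, c₁ ∈ C₁, c₂ ∈ C₂}` is a closed linear subspace of `H`, then the
additivity of normal cones holds at every point of `C₁ ∩ C₂`. -/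
theorem stmt_12 {H : Type*} [NormedAddCommGroup H] [InnerProductSpace ℝ H] [CompleteSpace H]
    (C₁ C₂ : Set H) (hC₁closed : IsClosed C₁) (hC₁conv : Convex ℝ C₁) (hC₁ne : C₁.Nonempty)
    (hC₂closed : IsClosed C₂) (hC₂conv : Convex ℝ C₂) (hC₂ne : C₂.Nonempty)
    (hcone : ∃ W : Submodule ℝ H, IsClosed (W : Set H) ∧
      (W : Set H) = {z : H | ∃ lam : ℝ, 0 ≤ lam ∧ ∃ c₁ ∈ C₁, ∃ c₂ ∈ C₂, z = lam • (c₁ - c₂)}) :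
    ∀ x ∈ C₁ ∩ C₂, normalCone C₁ x + normalCone C₂ x = normalCone (C₁ ∩ C₂) x := by
  rintro x ⟨hx₁, hx₂⟩
  obtain ⟨W, hWc, hW⟩ := hcone
  have : CompleteSpace W := hWc.completeSpace_coe
  apply Set.Subset.antisymm
  · rintro _ ⟨y₁, h₁, y₂, h₂, rfl⟩ c ⟨hc₁, hc₂⟩
    have := h₁ c hc₁
    have := h₂ c hc₂
    change ⟪y₁ + y₂, c - x⟫ ≤ 0
    rw [inner_add_left]
    linarith
  intro y hy
  let A : Set H := (fun z => z + x) ⁻¹' C₁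
  let B : Set H := (fun z => z + x) ⁻¹' C₂
  have hA : Convex ℝ A := hC₁conv.translate_preimage_left x
  have hB : Convex ℝ B := hC₂conv.translate_preimage_left x
  have hAc : IsClosed A := hC₁closed.preimage (continuous_add_const x)
  have hBc : IsClosed B := hC₂closed.preimage (continuous_add_const x)
  have hA0 : (0 : H) ∈ A := by simpa [A] using hx₁
  have hB0 : (0 : H) ∈ B := by simpa [B] using hx₂
  have hAB : ∀ a ∈ A, ∀ b ∈ B, a - b ∈ W := by
    intro a ha b hb
    rw [← SetLike.mem_coe, hW]
    exact ⟨1, zero_le_one, _, ha, _, hb, by simp⟩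
  obtain ⟨δ, hδ, hball⟩ := exists_ball_subset_sub_of_absorbing
    (S := A ∩ Metric.closedBall 0 1) (T := B ∩ Metric.closedBall 0 1)
    (hA.inter (convex_closedBall 0 1)) (hAc.inter Metric.isClosed_closedBall) ⟨hA0, by simp⟩
    (fun s hs => mem_closedBall_zero_iff.1 hs.2)
    (hB.inter (convex_closedBall 0 1)) (hBc.inter Metric.isClosed_closedBall) ⟨hB0, by simp⟩
    (fun s hs => mem_closedBall_zero_iff.1 hs.2) W (by
      intro w hw
      rw [← SetLike.mem_coe, hW] at hw
      obtain ⟨lam, hlam, c₁, hc₁, c₂, hc₂, rfl⟩ := hw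
      have ha : c₁ - x ∈ A := by simpa [A] using hc₁
      have hb : c₂ - x ∈ B := by simpa [B] using hc₂
      obtain ⟨n, hn⟩ := exists_nat_gt (max (max 1 lam) (lam * max ‖c₁ - x‖ ‖c₂ - x‖))
      simp only [max_lt_iff] at hn
      obtain ⟨⟨hn1, hnl⟩, hnm⟩ := hn
      have hn0 : (0 : ℝ) < n := by linarith
      have hmem : lam / n ∈ Set.Icc (0 : ℝ) 1 :=
        ⟨by positivity, by rw [div_le_one hn0]; exact hnl.le⟩
      have hbd : ∀ v : H, ‖v‖ ≤ max ‖c₁ - x‖ ‖c₂ - x‖ →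
          (lam / n) • v ∈ Metric.closedBall (0 : H) 1 := by
        intro v hv
        rw [mem_closedBall_zero_iff, norm_smul, Real.norm_of_nonneg hmem.1, div_mul_eq_mul_div,
          div_le_one hn0]
        exact (mul_le_mul_of_nonneg_left hv hlam).trans hnm.le
      have ha' := hA.smul_mem_of_zero_mem hA0 ha hmem
      have hb' := hB.smul_mem_of_zero_mem hB0 hb hmem
      refine ⟨n, _, ⟨ha', hbd _ (le_max_left _ _)⟩, _, ⟨hb', hbd _ (le_max_right _ _)⟩,
        hAB _ ha' _ hb', ?_⟩
      rw [← smul_sub, smul_smul, mul_div_cancel₀ _ hn0.ne', sub_sub_sub_cancel_right])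
  obtain ⟨p, hp⟩ := exists_inner_le_of_ball_subset_sub hA hB W hAB hδ
    (fun w hw hwδ => by
      obtain ⟨a, ha, b, hb, hab⟩ := hball w hw hwδ
      exact ⟨a, ha.1, b, hb.1, mem_closedBall_zero_iff.1 ha.2, hab⟩)
    (y := y) (fun c hc => by simpa using hy (c + x) hc)
  refine ⟨y - p, fun c hc => ?_, p, fun c hc => ?_, sub_add_cancel y p⟩
  · have h := hp (c - x) (by simpa [A] using hc) 0 hB0
    rw [sub_zero] at h
    rw [inner_sub_left]
    linarith
  · have h := hp 0 hA0 (c - x) (by simpa [B] using hc)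
    rw [zero_sub, inner_neg_right, inner_zero_right] at h
    linarith
end

section
/- Let (Ω, μ) be a measure space and a, b : Ω → ℝ measurable functions with a ≤ b almost everywhere. Let Σ = {σ ∈ L²(μ) : a ≤ σ ≤ b almost everywhere}. Suppose y ∈ L²(μ) satisfies the strict inequalities a(x) < y(x) < b(x) for almost every x (so in particular y ∈ Σ). Then the normal cone of Σ at y is trivial: if v ∈ L²(μ) satisfies ∫ v·(σ − y) dμ ≤ 0 for every σ ∈ Σ, then v = 0 almost everywhere. -/
open MeasureTheory

/-- In `L²(μ)`, at a point `y` lying strictly between the obstacles `a` and `b` almost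
everywhere, the normal cone to `Σ = {σ : a ≤ σ ≤ b a.e.}` is trivial: any `v ∈ L²(μ)`
with `∫ v·(σ - y) dμ ≤ 0` for all `σ ∈ Σ` vanishes almost everywhere. -/
theorem stmt_13 {Ω : Type*} [MeasurableSpace Ω] (μ : Measure Ω)
    (a b : Ω → ℝ) (ha : Measurable a) (hb : Measurable b)
    (hab : ∀ᵐ x ∂μ, a x ≤ b x)
    (y : Lp ℝ 2 μ) (hy : ∀ᵐ x ∂μ, a x < y x ∧ y x < b x)
    (v : Lp ℝ 2 μ)
    (hv : ∀ σ : Lp ℝ 2 μ, (∀ᵐ x ∂μ, a x ≤ σ x ∧ σ x ≤ b x) →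
      ∫ x, v x * (σ x - y x) ∂μ ≤ 0) :
    ∀ᵐ x ∂μ, v x = 0 := by
  -- Test with `σ = y + w`, where `w` is `v` truncated to the interval `[a - y, b - y]` around `0`.
  set w : Ω → ℝ := fun x => max (a x - y x) (min (b x - y x) (v x)) with hw
  have hw_meas : AEStronglyMeasurable w μ :=
    (ha.aestronglyMeasurable.sub (Lp.aestronglyMeasurable y)).sup
      ((hb.aestronglyMeasurable.sub (Lp.aestronglyMeasurable y)).inf (Lp.aestronglyMeasurable v))
  have hw_le : ∀ᵐ x ∂μ, ‖w x‖ ≤ ‖v x‖ := by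
    filter_upwards [hy] with x hx
    simp only [hw, Real.norm_eq_abs]
    grind
  have hw_mem : MemLp w 2 μ := (Lp.memLp v).mono hw_meas hw_le
  have hw_coe := hw_mem.coeFn_toLp
  have hσ := Lp.coeFn_add y hw_mem.toLp
  have hle := hv (y + hw_mem.toLp) (by
    filter_upwards [hy, hw_coe, hσ] with x hx h₁ h₂
    rw [h₂, Pi.add_apply, h₁]
    simp only [hw]
    grind)
  have hcongr : ∫ x, v x * ((y + hw_mem.toLp : Lp ℝ 2 μ) x - y x) ∂μ = ∫ x, v x * w x ∂μ := by
    refine integral_congr_ae ?_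
    filter_upwards [hw_coe, hσ] with x h₁ h₂
    rw [h₂, Pi.add_apply, h₁, add_sub_cancel_left]
  rw [hcongr] at hle
  have h_nonneg : 0 ≤ᵐ[μ] fun x => v x * w x := by
    filter_upwards [hy] with x hx
    rcases le_total 0 (v x) with h | h
    · exact mul_nonneg h (le_max_of_le_right (le_min (by linarith) h))
    · exact mul_nonneg_of_nonpos_of_nonpos h
        (max_le (by linarith) (min_le_of_right_le h))
  have h_zero := (integral_eq_zero_iff_of_nonneg_ae h_nonneg
    ((Lp.memLp v).integrable_mul hw_mem)).1 (hle.antisymm (integral_nonneg_of_ae h_nonneg))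
  filter_upwards [h_zero, hy] with x h₀ hx
  rcases mul_eq_zero.1 h₀ with h | h
  · exact h
  · simp only [hw] at h
    grind
end
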